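/- arXiv:2308.16359 — 2 statements merged into one kernel-verified Lean document; each statement's English description precedes it below -/
import Mathlib

section
/- Let T be a simplicial tree and let X be a finite subset of Aut(T) generating a subgroup G. Then there exists a finite generating set X′ of G such that either X′ contains a nontrivial elliptic element, or X′ is a strongly N-reduced free basis of G. In particular, if G is purely hyperbolic, then G is a free group admitting a strongly N-reduced free basis. -/
noncomputable section

open Pointwise

namespace TreePaper

variable {V : Type*}

section Defs

variable (T : SimpleGraph V) (v0 : V)

/-- The vertex set of the geodesic segment `[u, w]` in the tree `T`. -/
def seg (u w : V) : Set V := {x | T.dist u x + T.dist x w = T.dist u w}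

/-- `|g| = d(v0, g·v0)`. -/
def nrm (g : T ≃g T) : ℕ := T.dist v0 (g v0)

/-- `δ(g, h) = (|g| + |h| - |g⁻¹h|)/2`, as a rational number. -/
noncomputable def dlt (g h : T ≃g T) : ℚ :=
  ((nrm T v0 g : ℚ) + (nrm T v0 h : ℚ) - (nrm T v0 (g⁻¹ * h) : ℚ)) / 2

/-- An automorphism is elliptic if it fixes a vertex or inverts an edge. -/
def IsElliptic (g : T ≃g T) : Prop :=
  (∃ v : V, g v = v) ∨ (∃ u w : V, T.Adj u w ∧ g u = w ∧ g w = u)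

/-- Hyperbolic = not elliptic. -/
def IsHyperbolic (g : T ≃g T) : Prop := ¬ IsElliptic T g

/-- Translation length: the minimum of `d(v, g·v)` over all vertices `v`. -/
noncomputable def tl (g : T ≃g T) : ℕ := sInf (Set.range fun v : V => T.dist v (g v))

/-- The (vertex set of the) axis of `g`: vertices moved exactly the translation length. -/
def axisSet (g : T ≃g T) : Set V := {v : V | T.dist v (g v) = tl T g}

/-- A subgroup is purely hyperbolic if every nontrivial element is hyperbolic. -/
def PurelyHyperbolic (G : Subgroup (T ≃g T)) : Prop :=
  ∀ g ∈ G, g ≠ 1 → IsHyperbolic T g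

/-- `X^± = X ∪ X⁻¹`. -/
def Xpm (X : Set (T ≃g T)) : Set (T ≃g T) := X ∪ X⁻¹

/-- Condition N1: `X ∩ X⁻¹ = ∅`. -/
def N1 (X : Set (T ≃g T)) : Prop := X ∩ X⁻¹ = ∅

/-- Condition N2: `|xy| ≥ max (|x|, |y|)` for `x, y ∈ X^±` with `x ≠ y⁻¹`. -/
def N2 (X : Set (T ≃g T)) : Prop :=
  ∀ x ∈ Xpm T X, ∀ y ∈ Xpm T X, x ≠ y⁻¹ →
    max (nrm T v0 x) (nrm T v0 y) ≤ nrm T v0 (x * y)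

/-- Condition N3: `|xyz| > |x| + |z| - |y|` for suitable `x, y, z ∈ X^±`. -/
def N3 (X : Set (T ≃g T)) : Prop :=
  ∀ x ∈ Xpm T X, ∀ y ∈ Xpm T X, ∀ z ∈ Xpm T X, x ≠ y⁻¹ → y ≠ z⁻¹ →
    (nrm T v0 x : ℤ) + (nrm T v0 z : ℤ) - (nrm T v0 y : ℤ) < (nrm T v0 (x * y * z) : ℤ)

/-- Condition N2′: `2δ(x⁻¹, y) ≤ min (|x|, |y|)`. -/
noncomputable def N2' (X : Set (T ≃g T)) : Prop :=
  ∀ x ∈ Xpm T X, ∀ y ∈ Xpm T X, x ≠ y⁻¹ →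
    2 * dlt T v0 x⁻¹ y ≤ min (nrm T v0 x : ℚ) (nrm T v0 y : ℚ)

/-- Condition N3′: `δ(x⁻¹, y) + δ(y⁻¹, z) < |y|`. -/
noncomputable def N3' (X : Set (T ≃g T)) : Prop :=
  ∀ x ∈ Xpm T X, ∀ y ∈ Xpm T X, ∀ z ∈ Xpm T X, x ≠ y⁻¹ → y ≠ z⁻¹ →
    dlt T v0 x⁻¹ y + dlt T v0 y⁻¹ z < (nrm T v0 y : ℚ)

/-- `X` is N-reduced: no nontrivial elliptic elements, and N1, N2, N3 hold. -/
def NReduced (X : Set (T ≃g T)) : Prop :=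
  (∀ x ∈ X, x ≠ 1 → ¬ IsElliptic T x) ∧ N1 T X ∧ N2 T v0 X ∧ N3 T v0 X

/-- `H(g)`: the vertex set of the initial segment of `[v0, g·v0]` of length `⌊|g|/2⌋`. -/
def halfSet (g : T ≃g T) : Set V :=
  {x : V | x ∈ seg T v0 (g v0) ∧ T.dist v0 x ≤ nrm T v0 g / 2}

/-- The endpoint of `H(g)`: the vertex on `[v0, g·v0]` at distance `⌊|g|/2⌋` from `v0`.
(Since paths in a tree starting at `v0` are uniquely determined by their endpoints, we
identify the path `H(g)` with this vertex.) -/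
noncomputable def halfVertex (g : T ≃g T) : V :=
  letI := Classical.dec (∃ m, m ∈ seg T v0 (g v0) ∧ T.dist v0 m = nrm T v0 g / 2)
  if h : ∃ m, m ∈ seg T v0 (g v0) ∧ T.dist v0 m = nrm T v0 g / 2 then h.choose else v0

/-- `X` is a free basis of `⟨X⟩`: the homomorphism from the free group on `X` induced
by the inclusion is an isomorphism onto `⟨X⟩`. -/
def IsFreeBasis (X : Set (T ≃g T)) : Prop :=
  Function.Injective (FreeGroup.lift (fun x : X => (x : T ≃g T))) ∧
  MonoidHom.range (FreeGroup.lift (fun x : X => (x : T ≃g T))) = Subgroup.closure X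

/-- A subgroup of `Aut T` is discrete iff some finite set of vertices has trivial
pointwise stabilizer. -/
def IsDiscrete (G : Subgroup (T ≃g T)) : Prop :=
  ∃ F : Finset V, ∀ g ∈ G, (∀ v ∈ F, g v = v) → g = 1

end Defs

section Order

variable (T : SimpleGraph V) (v0 : V)

/-- The assumed properties of the chosen well-ordering of paths starting at `v0`
(paths from `v0` are identified with their endpoints): it is a well-order, shorter
paths precede longer paths, and it is lexicographic. -/
structure IsPathOrder (lt : V → V → Prop) : Prop where
  wellOrder : IsWellOrder V lt
  short : ∀ u w : V, T.dist v0 u < T.dist v0 w → lt u w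
  lex : ∀ u w : V, T.dist v0 u = T.dist v0 w → ∀ u' w' : V,
    u' ∈ seg T v0 u → w' ∈ seg T v0 w → T.dist v0 u' = T.dist v0 w' → lt u' w' → lt u w

/-- The ordering `≺` on two-element sets of paths (identified with their endpoints):
`A ≺ B` iff `A ≠ B` and the least element of the symmetric difference lies in `A`. -/
def pairLt (lt : V → V → Prop) (A B : Set V) : Prop :=
  A ≠ B ∧ ∃ m ∈ (A \ B) ∪ (B \ A), m ∈ A ∧ ∀ x ∈ (A \ B) ∪ (B \ A), x ≠ m → lt m x

/-- `g ≺ h` iff `|g| = |h|` and `{H(g), H(g⁻¹)} ≺ {H(h), H(h⁻¹)}`. -/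
noncomputable def autPrec (lt : V → V → Prop) (g h : T ≃g T) : Prop :=
  nrm T v0 g = nrm T v0 h ∧
    pairLt lt {halfVertex T v0 g, halfVertex T v0 g⁻¹}
      {halfVertex T v0 h, halfVertex T v0 h⁻¹}

/-- `g <* h` iff `|g| < |h|` or `g ≺ h`. -/
noncomputable def autLtStar (lt : V → V → Prop) (g h : T ≃g T) : Prop :=
  nrm T v0 g < nrm T v0 h ∨ autPrec T v0 lt g h

/-- Condition N4: `x <* xy` for all `x, y ∈ X^±` with `x ≠ y⁻¹`. -/
noncomputable def N4 (lt : V → V → Prop) (X : Set (T ≃g T)) : Prop :=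
  ∀ x ∈ Xpm T X, ∀ y ∈ Xpm T X, x ≠ y⁻¹ → autLtStar T v0 lt x (x * y)

/-- `X` is strongly N-reduced (w.r.t. `v0` and `<*`): a free basis satisfying N1 and N4. -/
noncomputable def StronglyNReduced (lt : V → V → Prop) (X : Set (T ≃g T)) : Prop :=
  IsFreeBasis T X ∧ N1 T X ∧ N4 T v0 lt X

end Order

section Words

variable (T : SimpleGraph V)

/-- The product `a₀ a₁ ⋯ a_{k-1}`. -/
def wordProd (a : ℕ → T ≃g T) (k : ℕ) : T ≃g T := ((List.range k).map a).prod

/-- The product `aᵢ a_{i+1} ⋯ a_j` (inclusive endpoints). -/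
def segProd (a : ℕ → T ≃g T) (i j : ℕ) : T ≃g T := ((List.range' i (j + 1 - i)).map a).prod

/-- `a 0, …, a (n-1)` is a reduced word in `X`: each letter lies in `X^±` and no letter
is followed by its inverse. -/
def IsReducedWord (X : Set (T ≃g T)) (a : ℕ → T ≃g T) (n : ℕ) : Prop :=
  (∀ i < n, a i ∈ Xpm T X) ∧ ∀ i, i + 1 < n → a (i + 1) ≠ (a i)⁻¹

end Words

section Geometry

variable (T : SimpleGraph V) (v0 : V)

/-- `p` is a nearest-point projection of `w` to the set `A`. -/
def NearestPt (A : Set V) (w p : V) : Prop :=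
  p ∈ A ∧ ∀ z ∈ A, T.dist w p ≤ T.dist w z

/-- Distance between two sets of vertices. -/
noncomputable def setDist (A B : Set V) : ℕ :=
  sInf {n : ℕ | ∃ a ∈ A, ∃ b ∈ B, T.dist a b = n}

/-- A vertex `p` of the axis of `g` lies in the half-open interval `U_g^0`
(of radius `l(g)/2` about the projection `c` of `v0`, closed at the `<`-smaller end):
either `d(c,p) < l(g)/2`, or `d(c,p) = l(g)/2` and `p` precedes the opposite boundary
vertex in the ordering. -/
def inU0 (lt : V → V → Prop) (g : T ≃g T) (c p : V) : Prop :=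
  2 * T.dist c p < tl T g ∨
    (2 * T.dist c p = tl T g ∧
      ∀ p', p' ∈ axisSet T g → T.dist c p' = T.dist c p → p' ≠ p → lt p p')

/-- `X` admits a fundamental system: `X` has no nontrivial elliptic elements and for all
distinct `g, h ∈ X`, the projection of the axis of `h` to the axis of `g` is contained
in `U_g^0`. -/
def AdmitsFundamentalSystem (lt : V → V → Prop) (X : Set (T ≃g T)) : Prop :=
  (∀ x ∈ X, x ≠ 1 → ¬ IsElliptic T x) ∧
  ∀ g ∈ X, ∀ h ∈ X, g ≠ h → ∀ c z p : V,
    NearestPt T (axisSet T g) v0 c → z ∈ axisSet T h →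
    NearestPt T (axisSet T g) z p → inU0 T lt g c p

end Geometry


/-! ### Tree metric facts -/

section TreeFacts

variable {T : SimpleGraph V}

lemma exists_pt (hT : T.IsTree) (u w : V) (k : ℕ) (hk : k ≤ T.dist u w) :
    ∃ m, T.dist u m = k ∧ T.dist u m + T.dist m w = T.dist u w := by
  obtain ⟨p, hp⟩ := hT.connected.exists_walk_length_eq_dist u w
  refine ⟨p.getVert k, ?_⟩
  have h1 : T.dist u (p.getVert k) ≤ k :=
    (SimpleGraph.dist_le (p.take k)).trans (by rw [SimpleGraph.Walk.take_length]; exact min_le_left _ _)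
  have h2 : T.dist (p.getVert k) w ≤ p.length - k :=
    (SimpleGraph.dist_le (p.drop k)).trans (by rw [SimpleGraph.Walk.drop_length])
  have h3 := hT.connected.dist_triangle (u := u) (v := p.getVert k) (w := w)
  omega

lemma dist_across (hT : T.IsTree) {a b x y : V} (hab : T.Adj a b)
    (hx : T.dist x b = T.dist x a + 1) (hy : T.dist y a = T.dist y b + 1) :
    T.dist x y = T.dist x a + 1 + T.dist b y := by
  classical
  obtain ⟨p, hp⟩ := hT.connected.exists_walk_length_eq_dist x a
  obtain ⟨q, hq⟩ := hT.connected.exists_walk_length_eq_dist b y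
  have hpp := p.isPath_of_length_eq_dist hp
  have hqp := q.isPath_of_length_eq_dist hq
  have key1 : ∀ z ∈ p.support, T.dist z b = T.dist z a + 1 := by
    intro z hz
    have h1 := SimpleGraph.dist_le (p.takeUntil z hz)
    have h2 := SimpleGraph.dist_le (p.dropUntil z hz)
    have h3 : (p.takeUntil z hz).length + (p.dropUntil z hz).length = p.length := by
      rw [← SimpleGraph.Walk.length_append, SimpleGraph.Walk.take_spec]
    have h4 := hT.connected.dist_triangle (u := x) (v := z) (w := b)
    have h5 := hT.dist_eq_dist_add_one_of_adj z hab
    omega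
  have key2 : ∀ z ∈ q.support, T.dist z a = T.dist z b + 1 := by
    intro z hz
    have h1 := SimpleGraph.dist_le (q.takeUntil z hz)
    have h2 := SimpleGraph.dist_le (q.dropUntil z hz)
    have h3 : (q.takeUntil z hz).length + (q.dropUntil z hz).length = q.length := by
      rw [← SimpleGraph.Walk.length_append, SimpleGraph.Walk.take_spec]
    have h4 := hT.connected.dist_triangle (u := y) (v := z) (w := a)
    have h5 := hT.dist_eq_dist_add_one_of_adj z hab
    have c1 := T.dist_comm (u := y) (v := z)
    have c2 := T.dist_comm (u := y) (v := b)
    have c3 := T.dist_comm (u := z) (v := b)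
    omega
  have hpath : (p.append (SimpleGraph.Walk.cons hab q)).IsPath := by
    rw [SimpleGraph.Walk.isPath_def, SimpleGraph.Walk.support_append,
      SimpleGraph.Walk.support_cons, List.tail_cons, List.nodup_append]
    refine ⟨hpp.support_nodup, hqp.support_nodup, ?_⟩
    rintro z hz w hw rfl
    have := key1 z hz
    have := key2 z hw
    omega
  obtain ⟨r, hr, hr'⟩ := hT.connected.exists_path_of_dist x y
  have := (hT.isAcyclic.subsingleton_path x y).elim ⟨r, hr⟩ ⟨_, hpath⟩
  have h2 : r = p.append (SimpleGraph.Walk.cons hab q) := congrArg Subtype.val this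
  rw [← hr', h2, SimpleGraph.Walk.length_append, SimpleGraph.Walk.length_cons]
  omega

lemma four_pt (hT : T.IsTree) (a b c d : V) :
    T.dist a b + T.dist c d ≤ max (T.dist a c + T.dist b d) (T.dist a d + T.dist b c) := by
  induction hn : T.dist c d generalizing d with
  | zero =>
    have := (hT.connected.dist_eq_zero_iff).1 hn
    subst this
    have h4 := hT.connected.dist_triangle (u := a) (v := c) (w := b)
    have c3 := T.dist_comm (u := b) (v := c)
    omega
  | succ n ih =>
    obtain ⟨e, he1, he2⟩ := exists_pt hT c d n (by omega)
    have hed : T.Adj e d := by rw [← SimpleGraph.dist_eq_one_iff_adj]; omega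
    have ih' := ih e he1
    have hce : T.dist c d = T.dist c e + 1 := by omega
    have c1 := T.dist_comm (u := c) (v := a)
    have c2 := T.dist_comm (u := c) (v := b)
    have c3 := T.dist_comm (u := a) (v := b)
    have c4 := T.dist_comm (u := d) (v := a)
    have c5 := T.dist_comm (u := d) (v := b)
    rcases hT.dist_eq_dist_add_one_of_adj a hed with ha | ha <;>
    rcases hT.dist_eq_dist_add_one_of_adj b hed with hb | hb
    · have h1 := dist_across hT hed hce hb
      have h2 := dist_across hT hed hce ha
      have h4 := hT.connected.dist_triangle (u := a) (v := d) (w := b)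
      omega
    · have h1 := dist_across hT hed hb ha
      have h2 := dist_across hT hed hce ha
      omega
    · have h1 := dist_across hT hed ha hb
      have h2 := dist_across hT hed hce hb
      omega
    · omega

/-- The parity of distances in a tree. -/
lemma parity (hT : T.IsTree) (a b c : V) :
    (T.dist a b + T.dist b c + T.dist a c) % 2 = 0 := by
  induction hn : T.dist b c generalizing c with
  | zero =>
    have := (hT.connected.dist_eq_zero_iff).1 hn
    subst this
    omega
  | succ n ih =>
    obtain ⟨e, he1, he2⟩ := exists_pt hT b c n (by omega)
    have hed : T.Adj e c := by rw [← SimpleGraph.dist_eq_one_iff_adj]; omega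
    have ih' := ih e he1
    rcases hT.dist_eq_dist_add_one_of_adj a hed with ha | ha <;> omega

lemma pt_unique (hT : T.IsTree) {u w m m' : V} (h : m ∈ seg T u w) (h' : m' ∈ seg T u w)
    (hd : T.dist u m = T.dist u m') : m = m' := by
  simp only [seg, Set.mem_ofPred_eq] at h h'
  have := four_pt hT m m' u w
  rw [← hT.connected.dist_eq_zero_iff]
  have c1 := T.dist_comm (u := u) (v := m)
  have c2 := T.dist_comm (u := u) (v := m')
  omega

lemma seg_of_share (hT : T.IsTree) {v u w m : V} (h : m ∈ seg T v u)
    (hd : 2 * T.dist v m + T.dist u w ≤ T.dist v u + T.dist v w) : m ∈ seg T v w := by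
  simp only [seg, Set.mem_ofPred_eq] at h ⊢
  have := four_pt hT m w v u
  have c1 := T.dist_comm (u := v) (v := m)
  have c2 := T.dist_comm (u := u) (v := w)
  have c3 := T.dist_comm (u := v) (v := w)
  have c4 := hT.connected.dist_triangle (u := v) (v := m) (w := w)
  omega

lemma seg_of_le (hT : T.IsTree) {v u m m' : V} (h : m ∈ seg T v u) (h' : m' ∈ seg T v u)
    (hd : T.dist v m ≤ T.dist v m') : m ∈ seg T v m' := by
  apply seg_of_share hT h
  simp only [seg, Set.mem_ofPred_eq] at h'
  have c1 := T.dist_comm (u := u) (v := m')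
  omega

lemma dist_app (g : T ≃g T) (u w : V) : T.dist (g u) (g w) = T.dist u w := by
  have key : ∀ (g : T ≃g T) (u w : V), T.Reachable u w → T.dist (g u) (g w) ≤ T.dist u w := by
    intro g u w h
    obtain ⟨p, hp⟩ := h.exists_walk_length_eq_dist
    rw [← hp, ← SimpleGraph.Walk.length_map (g : T →g T) p]
    exact SimpleGraph.dist_le _
  by_cases h : T.Reachable u w
  · refine le_antisymm (key g u w h) ?_
    have := key g.symm (g u) (g w) (h.map (g : T →g T))
    simpa using this
  · rw [SimpleGraph.dist_eq_zero_of_not_reachable h, SimpleGraph.dist_eq_zero_of_not_reachable]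
    rwa [SimpleGraph.Iso.reachable_iff]

end TreeFacts

section AutFacts

variable {T : SimpleGraph V} {v0 : V}

lemma inv_app (g : T ≃g T) (u : V) : g⁻¹ (g u) = u := by
  rw [← RelIso.mul_apply]; simp

lemma app_inv (g : T ≃g T) (u : V) : g (g⁻¹ u) = u := by
  rw [← RelIso.mul_apply]; simp

lemma nrm_inv (g : T ≃g T) : nrm T v0 g⁻¹ = nrm T v0 g := by
  unfold nrm
  rw [← dist_app g, app_inv, SimpleGraph.dist_comm]

lemma dist_eq_nrm (g h : T ≃g T) : T.dist (g v0) (h v0) = nrm T v0 (g⁻¹ * h) := by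
  unfold nrm
  rw [← dist_app g⁻¹, inv_app, RelIso.mul_apply]

lemma nrm_one : nrm T v0 (1 : T ≃g T) = 0 := by simp [nrm]

lemma nrm_parity (hT : T.IsTree) (g h : T ≃g T) :
    (nrm T v0 g + nrm T v0 h + nrm T v0 (g * h)) % 2 = 0 := by
  have h1 := parity hT v0 (g⁻¹ v0) (h v0)
  rw [dist_eq_nrm, inv_inv] at h1
  change (nrm T v0 g⁻¹ + _ + nrm T v0 h) % 2 = 0 at h1
  rw [nrm_inv] at h1
  omega

lemma half_spec (hT : T.IsTree) (g : T ≃g T) :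
    halfVertex T v0 g ∈ seg T v0 (g v0) ∧ T.dist v0 (halfVertex T v0 g) = nrm T v0 g / 2 := by
  have h : ∃ m, m ∈ seg T v0 (g v0) ∧ T.dist v0 m = nrm T v0 g / 2 := by
    obtain ⟨m, h1, h2⟩ := exists_pt hT v0 (g v0) (nrm T v0 g / 2) (Nat.div_le_self _ _)
    exact ⟨m, h2, h1⟩
  unfold halfVertex
  rw [dif_pos h]
  exact h.choose_spec

lemma half_unique (hT : T.IsTree) {g : T ≃g T} {m : V} (h : m ∈ seg T v0 (g v0))
    (hd : T.dist v0 m = nrm T v0 g / 2) : m = halfVertex T v0 g :=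
  pt_unique hT h (half_spec hT g).1 (hd.trans (half_spec hT g).2.symm)

lemma flip (g : T ≃g T) {m : V} (h : m ∈ seg T v0 (g⁻¹ v0)) :
    g m ∈ seg T v0 (g v0) ∧ T.dist v0 (g m) + T.dist v0 m = nrm T v0 g := by
  simp only [seg, Set.mem_ofPred_eq] at h ⊢
  have h1 : T.dist v0 (g m) = T.dist m (g⁻¹ v0) := by
    rw [← dist_app g m, app_inv, SimpleGraph.dist_comm]
  have h2 : T.dist (g m) (g v0) = T.dist v0 m := by
    rw [dist_app, SimpleGraph.dist_comm]
  have h3 : T.dist v0 (g⁻¹ v0) = nrm T v0 g := nrm_inv g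
  have h4 : T.dist v0 (g v0) = nrm T v0 g := rfl
  omega

/-- Shared initial segments, in terms of lengths. -/
lemma share (hT : T.IsTree) {g h : T ≃g T} {m : V} (hm : m ∈ seg T v0 (g v0))
    (hd : 2 * T.dist v0 m + nrm T v0 (g⁻¹ * h) ≤ nrm T v0 g + nrm T v0 h) :
    m ∈ seg T v0 (h v0) := by
  apply seg_of_share hT hm
  rw [dist_eq_nrm]
  exact hd

lemma sq_elliptic (hT : T.IsTree) (g : T ≃g T) (h : nrm T v0 (g * g) ≤ nrm T v0 g) :
    IsElliptic T g := by
  obtain ⟨h1, h2⟩ := half_spec (v0 := v0) hT g⁻¹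
  set m := halfVertex T v0 g⁻¹
  obtain ⟨h3, h4⟩ := flip g h1
  have hp := nrm_parity (v0 := v0) hT g g
  have hi : nrm T v0 g⁻¹ = nrm T v0 g := nrm_inv g
  have hi2 : nrm T v0 (g⁻¹ * g⁻¹) = nrm T v0 (g * g) := by
    rw [← mul_inv_rev, nrm_inv]
  have h5 : g m ∈ seg T v0 (g⁻¹ v0) := by
    apply share hT h3
    omega
  by_cases he : nrm T v0 g % 2 = 0
  · left
    exact ⟨m, pt_unique hT h5 h1 (by omega)⟩
  · right
    obtain ⟨h6, h7⟩ := flip g h5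
    have h8 : m ∈ seg T v0 (g v0) := by
      apply share hT h1
      rw [inv_inv]
      omega
    refine ⟨m, g m, ?_, rfl, pt_unique hT h6 h8 (by omega)⟩
    have h9 := seg_of_le hT h1 h5 (by omega)
    simp only [seg, Set.mem_ofPred_eq] at h9
    rw [← SimpleGraph.dist_eq_one_iff_adj]
    omega

lemma half_mul (hT : T.IsTree) {x y : T ≃g T} (h : nrm T v0 (x * y) = nrm T v0 x)
    (hy : nrm T v0 y ≤ nrm T v0 x) : halfVertex T v0 x = halfVertex T v0 (x * y) := by
  obtain ⟨h1, h2⟩ := half_spec (v0 := v0) hT x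
  apply half_unique hT
  · apply share hT h1
    rw [inv_mul_cancel_left]
    omega
  · omega

lemma tie_elliptic (hT : T.IsTree) {x y : T ≃g T} (h : nrm T v0 (x * y) = nrm T v0 x)
    (hy : nrm T v0 y ≤ nrm T v0 x)
    (he : halfVertex T v0 x⁻¹ = halfVertex T v0 (x * y)⁻¹) : IsElliptic T y := by
  left
  obtain ⟨h1, h2⟩ := half_spec (v0 := v0) hT x⁻¹
  set m := halfVertex T v0 x⁻¹
  have hi : nrm T v0 x⁻¹ = nrm T v0 x := nrm_inv x
  have hi2 : nrm T v0 (x * y)⁻¹ = nrm T v0 (x * y) := nrm_inv _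
  obtain ⟨h3, h4⟩ := flip x h1
  have hp := nrm_parity (v0 := v0) hT x y
  have h5 : x m ∈ seg T v0 ((x * y) v0) := by
    apply share hT h3
    rw [inv_mul_cancel_left]
    omega
  rw [← inv_inv (x * y)] at h5
  obtain ⟨h6, h7⟩ := flip _ h5
  have h8 : (x * y)⁻¹ (x m) = m := by
    exact (half_unique hT h6 (by omega)).trans he.symm
  refine ⟨m, ?_⟩
  have h9 : (x * y) ((x * y)⁻¹ (x m)) = (x * y) m := by rw [h8]
  rw [app_inv, RelIso.mul_apply] at h9
  exact (x.injective h9).symm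

lemma half_eq_elliptic (hT : T.IsTree) {y : T ≃g T} (hy : nrm T v0 y % 2 = 0)
    (he : halfVertex T v0 y = halfVertex T v0 y⁻¹) : IsElliptic T y := by
  left
  obtain ⟨h1, h2⟩ := half_spec (v0 := v0) hT y⁻¹
  have hi : nrm T v0 y⁻¹ = nrm T v0 y := nrm_inv y
  obtain ⟨h3, h4⟩ := flip y h1
  refine ⟨halfVertex T v0 y⁻¹, ?_⟩
  conv_rhs => rw [← he]
  exact half_unique hT h3 (by omega)

lemma order_half (hT : T.IsTree) [LinearOrder V] (hlt : IsPathOrder T v0 (fun a b : V => a < b))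
    {x y : T ≃g T} (h : nrm T v0 (x * y) = nrm T v0 x) (hy : nrm T v0 y ≤ nrm T v0 x)
    (hell : ¬ IsElliptic T y) (hle : halfVertex T v0 x⁻¹ ≤ halfVertex T v0 (x * y)⁻¹) :
    halfVertex T v0 y < halfVertex T v0 y⁻¹ := by
  have hp := nrm_parity (v0 := v0) hT x y
  by_contra hcon
  have hne : halfVertex T v0 y ≠ halfVertex T v0 y⁻¹ :=
    fun he => hell (half_eq_elliptic hT (by omega) he)
  have hlt' : halfVertex T v0 y⁻¹ < halfVertex T v0 y :=
    lt_of_le_of_ne (not_lt.1 hcon) hne.symm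
  have i1 : nrm T v0 x⁻¹ = nrm T v0 x := nrm_inv x
  have i2 : nrm T v0 y⁻¹ = nrm T v0 y := nrm_inv y
  have i3 : nrm T v0 (x * y)⁻¹ = nrm T v0 (x * y) := nrm_inv _
  obtain ⟨a1, a2⟩ := half_spec (v0 := v0) hT x⁻¹
  obtain ⟨b1, b2⟩ := half_spec (v0 := v0) hT (x * y)⁻¹
  obtain ⟨c1, c2⟩ := half_spec (v0 := v0) hT y
  obtain ⟨d1, d2⟩ := half_spec (v0 := v0) hT y⁻¹
  have e1 : halfVertex T v0 y ∈ seg T v0 (x⁻¹ v0) := by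
    have i4 : nrm T v0 (y⁻¹ * x⁻¹) = nrm T v0 (x * y) := by rw [← mul_inv_rev, nrm_inv]
    apply share hT c1
    omega
  have e2 : halfVertex T v0 y⁻¹ ∈ seg T v0 ((x * y)⁻¹ v0) := by
    have i5 : nrm T v0 ((y⁻¹)⁻¹ * (x * y)⁻¹) = nrm T v0 x := by
      rw [mul_inv_rev, inv_inv, mul_inv_cancel_left, nrm_inv]
    apply share hT d1
    omega
  have e3 := seg_of_le hT e1 a1 (by omega)
  have e4 := seg_of_le hT e2 b1 (by omega)
  have := hlt.lex (halfVertex T v0 (x * y)⁻¹) (halfVertex T v0 x⁻¹) (by omega) _ _ e4 e3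
    (by omega) hlt'
  exact absurd hle (not_le.2 this)

end AutFacts

section Keys

variable {T : SimpleGraph V} {v0 : V} [LinearOrder V]

/-- The key used for proving freeness. -/
def key1 (T : SimpleGraph V) (v0 : V) (g : T ≃g T) : ℕ ×ₗ (V ×ₗ V) :=
  toLex (nrm T v0 g, toLex (min (halfVertex T v0 g) (halfVertex T v0 g⁻¹),
    max (halfVertex T v0 g) (halfVertex T v0 g⁻¹)))

open Classical in
/-- The key reflecting the ordering `<*`. -/
def key2 (T : SimpleGraph V) (v0 : V) (g : T ≃g T) : ℕ ×ₗ (V ×ₗ WithTop V) :=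
  toLex (nrm T v0 g, toLex (min (halfVertex T v0 g) (halfVertex T v0 g⁻¹),
    if halfVertex T v0 g = halfVertex T v0 g⁻¹ then ⊤ else
    ((max (halfVertex T v0 g) (halfVertex T v0 g⁻¹) : V) : WithTop V)))

/-- The properties of a key needed for Nielsen reduction. -/
structure GoodKey {α : Type*} [LinearOrder α] (T : SimpleGraph V) (v0 : V)
    (key : (T ≃g T) → α) : Prop where
  inv : ∀ g, key g⁻¹ = key g
  lt : ∀ g h, nrm T v0 g < nrm T v0 h → key g < key h
  eq : ∀ g h, key g = key h → halfVertex T v0 g = halfVertex T v0 h →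
    halfVertex T v0 g⁻¹ = halfVertex T v0 h⁻¹

lemma good_key1 : GoodKey T v0 (key1 T v0) where
  inv g := by
    simp only [key1, nrm_inv, inv_inv, min_comm, max_comm]
  lt g h hl := by
    rw [key1, key1, Prod.Lex.toLex_lt_toLex]
    exact Or.inl hl
  eq g h he hh := by
    simp only [key1, EmbeddingLike.apply_eq_iff_eq, Prod.mk.injEq] at he
    grind

lemma good_key2 : GoodKey T v0 (key2 T v0) where
  inv g := by
    simp only [key2, nrm_inv, inv_inv, min_comm, max_comm, eq_comm]
  lt g h hl := by
    rw [key2, key2, Prod.Lex.toLex_lt_toLex]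
    exact Or.inl hl
  eq g h he hh := by
    simp only [key2, EmbeddingLike.apply_eq_iff_eq, Prod.mk.injEq] at he
    obtain ⟨-, h1, h2⟩ := he
    split_ifs at h2 with h3 h4 h4
    · rw [← h3, ← h4, hh]
    · exact absurd h2.symm WithTop.coe_ne_top
    · exact absurd h2 WithTop.coe_ne_top
    · rw [WithTop.coe_inj] at h2
      grind

lemma key1_le {x w : T ≃g T} (hk : key1 T v0 x ≤ key1 T v0 w) (hn : nrm T v0 x = nrm T v0 w)
    (hh : halfVertex T v0 x = halfVertex T v0 w) :
    halfVertex T v0 x⁻¹ ≤ halfVertex T v0 w⁻¹ := by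
  simp only [key1, Prod.Lex.toLex_le_toLex, hn, hh, lt_irrefl, false_or, true_and] at hk
  grind

lemma pairLt_of {a b c d : V} (h : min a b < min c d ∨ (min a b = min c d ∧ a ≠ b ∧
    (c = d ∨ max a b < max c d))) : pairLt (fun a b : V => a < b) {a, b} {c, d} := by
  have key : ∀ a b c d : V, a ≤ b → c ≤ d → (a < c ∨ (a = c ∧ a ≠ b ∧ (c = d ∨ b < d))) →
      pairLt (fun a b : V => a < b) {a, b} {c, d} := by
    intro a b c d hab hcd h
    rcases h with h | ⟨rfl, h1, h2⟩
    · refine ⟨?_, a, ?_, by simp, ?_⟩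
      · intro he
        have : a ∈ ({c, d} : Set V) := he ▸ by simp
        simp only [Set.mem_insert_iff, Set.mem_singleton_iff] at this
        grind
      · simp only [Set.mem_union, Set.mem_sdiff, Set.mem_insert_iff, Set.mem_singleton_iff]
        grind
      · simp only [Set.mem_union, Set.mem_sdiff, Set.mem_insert_iff, Set.mem_singleton_iff]
        grind
    · refine ⟨?_, b, ?_, by simp, ?_⟩
      · intro he
        have : b ∈ ({a, d} : Set V) := he ▸ by simp
        simp only [Set.mem_insert_iff, Set.mem_singleton_iff] at this
        grind
      · simp only [Set.mem_union, Set.mem_sdiff, Set.mem_insert_iff, Set.mem_singleton_iff]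
        grind
      · simp only [Set.mem_union, Set.mem_sdiff, Set.mem_insert_iff, Set.mem_singleton_iff]
        grind
  rcases le_total a b with h1 | h1 <;> rcases le_total c d with h2 | h2
  · exact key a b c d h1 h2 (by grind)
  · rw [Set.pair_comm c d]
    exact key a b d c h1 h2 (by grind)
  · rw [Set.pair_comm a b]
    exact key b a c d h1 h2 (by grind)
  · rw [Set.pair_comm a b, Set.pair_comm c d]
    exact key b a d c h1 h2 (by grind)

lemma key2_lt {x w : T ≃g T} (hk : key2 T v0 x < key2 T v0 w) :
    autLtStar T v0 (fun a b : V => a < b) x w := by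
  simp only [key2, Prod.Lex.toLex_lt_toLex] at hk
  rcases hk with hk | ⟨hk1, hk2⟩
  · exact Or.inl hk
  · refine Or.inr ⟨hk1, pairLt_of ?_⟩
    rcases hk2 with hk | ⟨hk3, hk4⟩
    · exact Or.inl hk
    · refine Or.inr ⟨hk3, ?_⟩
      split_ifs at hk4 with h1 h2 h2
      · exact absurd hk4 (lt_irrefl _)
      · exact absurd hk4 (not_lt.2 le_top)
      · exact ⟨h1, Or.inl h2⟩
      · exact ⟨h1, Or.inr (WithTop.coe_lt_coe.1 hk4)⟩

end Keys

section Reduction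

variable {T : SimpleGraph V} {v0 : V} {ι : Type*}

/-- The letter (a generator or its inverse) attached to `p`. -/
def letter (f : FreeGroup ι →* (T ≃g T)) (p : ι × Bool) : T ≃g T :=
  cond p.2 (f (FreeGroup.of p.1)) (f (FreeGroup.of p.1))⁻¹

lemma letter_inv (f : FreeGroup ι →* (T ≃g T)) (i : ι) (b : Bool) :
    (letter f (i, b))⁻¹ = letter f (i, !b) := by
  cases b <;> simp [letter]

lemma hom_mk (f : FreeGroup ι →* (T ≃g T)) (L : List (ι × Bool)) :
    f (FreeGroup.mk L) = (L.map (letter f)).prod := by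
  have : f = FreeGroup.lift (fun i => f (FreeGroup.of i)) := by
    apply FreeGroup.ext_hom
    intro a
    simp
  conv_lhs => rw [this]
  rw [FreeGroup.lift_mk]
  rfl

/-- Words in a Nielsen reduced system have positive length. -/
lemma word_pos (hT : T.IsTree) (a : ι × Bool → (T ≃g T))
    (hpos : ∀ p, 0 < nrm T v0 (a p))
    (h2 : ∀ p q : ι × Bool, (p.1 = q.1 → p.2 = q.2) → nrm T v0 (a q) ≤ nrm T v0 (a p * a q))
    (h3 : ∀ p q r : ι × Bool, (p.1 = q.1 → p.2 = q.2) → (q.1 = r.1 → q.2 = r.2) →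
      nrm T v0 (a p) + nrm T v0 (a r) < nrm T v0 (a p * a q) + nrm T v0 (a q * a r))
    (L : List (ι × Bool)) : ∀ l, FreeGroup.IsReduced (l :: L) →
      0 < nrm T v0 (((l :: L).map a).prod) ∧ ∀ p : ι × Bool, (p.1 = l.1 → p.2 = l.2) →
        nrm T v0 (((l :: L).map a).prod) + nrm T v0 (a p * a l) =
          nrm T v0 (a l) + nrm T v0 (a p * ((l :: L).map a).prod) := by
  induction L with
  | nil =>
    intro l _
    simp only [List.map_cons, List.map_nil, List.prod_cons, List.prod_nil, mul_one]
    exact ⟨hpos l, fun p _ => trivial⟩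
  | cons l2 L ih =>
    intro l hred
    rw [FreeGroup.isReduced_cons_cons] at hred
    obtain ⟨hll, hred⟩ := hred
    obtain ⟨ih1, ih2⟩ := ih l2 hred
    have ih3 := ih2 l hll
    rw [List.map_cons, List.prod_cons]
    set w' := ((l2 :: L).map a).prod
    have h2' := h2 l l2 hll
    refine ⟨by omega, ?_⟩
    intro p hp
    have h3' := h3 p l l2 hp hll
    have d1 : T.dist ((a p)⁻¹ v0) (a l v0) = nrm T v0 (a p * a l) := by
      rw [dist_eq_nrm, inv_inv]
    have d2 : T.dist ((a p)⁻¹ v0) ((a l * w') v0) = nrm T v0 (a p * (a l * w')) := by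
      rw [dist_eq_nrm, inv_inv]
    have d3 : T.dist (a l v0) ((a l * w') v0) = nrm T v0 w' := by
      rw [dist_eq_nrm, inv_mul_cancel_left]
    have d4 : T.dist v0 ((a p)⁻¹ v0) = nrm T v0 (a p) := nrm_inv _
    have d5 : T.dist v0 (a l v0) = nrm T v0 (a l) := rfl
    have d6 : T.dist v0 ((a l * w') v0) = nrm T v0 (a l * w') := rfl
    have f1 := four_pt hT v0 (a l v0) ((a p)⁻¹ v0) ((a l * w') v0)
    have f2 := four_pt hT v0 ((a l * w') v0) ((a p)⁻¹ v0) (a l v0)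
    have e1 := T.dist_comm (u := (a p)⁻¹ v0) (v := a l v0)
    have e2 := T.dist_comm (u := (a p)⁻¹ v0) (v := (a l * w') v0)
    have e3 := T.dist_comm (u := a l v0) (v := (a l * w') v0)
    omega

/-- An elementary Nielsen transformation, as a homomorphism. -/
def nielHom [DecidableEq ι] (i j : ι) (m n : ℤ) : FreeGroup ι →* FreeGroup ι :=
  FreeGroup.lift (fun k => if k = i then
    FreeGroup.of j ^ m * FreeGroup.of i * FreeGroup.of j ^ n else FreeGroup.of k)

lemma nielHom_comp [DecidableEq ι] {i j : ι} (hij : j ≠ i) (m n : ℤ) :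
    (nielHom i j (-m) (-n)).comp (nielHom i j m n) = MonoidHom.id _ := by
  apply FreeGroup.ext_hom
  intro k
  by_cases hk : k = i
  · subst hk
    simp [nielHom, hij, mul_assoc]
  · simp [nielHom, hk]

/-- An elementary Nielsen transformation, as an automorphism. -/
def niel [DecidableEq ι] {i j : ι} (hij : j ≠ i) (m n : ℤ) : FreeGroup ι ≃* FreeGroup ι :=
  MonoidHom.toMulEquiv (nielHom i j m n) (nielHom i j (-m) (-n)) (nielHom_comp hij m n)
    (by simpa using nielHom_comp hij (-m) (-n))

lemma range_eq_closure (f : FreeGroup ι →* (T ≃g T)) :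
    f.range = Subgroup.closure (Set.range fun k => f (FreeGroup.of k)) := by
  rw [MonoidHom.range_eq_map, ← FreeGroup.closure_range_of, MonoidHom.map_closure,
    ← Set.range_comp]
  rfl

lemma not_redundant [Finite ι] {G : Subgroup (T ≃g T)} (f : FreeGroup ι →* (T ≃g T))
    (hf : f.range = G)
    (hmin : ∀ Y : Set (T ≃g T), Y.Finite → Subgroup.closure Y = G → Nat.card ι ≤ Y.ncard)
    (i : ι) :
    f (FreeGroup.of i) ∉ Subgroup.closure ((fun k => f (FreeGroup.of k)) '' {k | k ≠ i}) := by
  intro hmem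
  have hcl : Subgroup.closure ((fun k => f (FreeGroup.of k)) '' {k | k ≠ i}) = G := by
    rw [← hf, range_eq_closure]
    apply le_antisymm
    · exact Subgroup.closure_mono (Set.image_subset_range _ _)
    · rw [Subgroup.closure_le]
      rintro _ ⟨k, rfl⟩
      by_cases hk : k = i
      · subst hk; exact hmem
      · exact Subgroup.subset_closure ⟨k, hk, rfl⟩
  have h1 := hmin _ (Set.toFinite _) hcl
  have h2 : ((fun k => f (FreeGroup.of k)) '' {k | k ≠ i}).ncard ≤ ({k | k ≠ i} : Set ι).ncard :=
    Set.ncard_image_le (Set.toFinite _)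
  have h3 : ({k | k ≠ i} : Set ι).ncard < Nat.card ι := by
    apply Set.ncard_lt_card
    intro h
    have : i ∈ ({k | k ≠ i} : Set ι) := h ▸ Set.mem_univ i
    exact this rfl
  omega

lemma letter_mem (f : FreeGroup ι →* (T ≃g T)) (K : Subgroup (T ≃g T)) (p : ι × Bool) :
    letter f p ∈ K ↔ f (FreeGroup.of p.1) ∈ K := by
  obtain ⟨i, b⟩ := p
  cases b <;> simp [letter]

lemma letter_ne [Finite ι] {G : Subgroup (T ≃g T)} (f : FreeGroup ι →* (T ≃g T))
    (hf : f.range = G)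
    (hmin : ∀ Y : Set (T ≃g T), Y.Finite → Subgroup.closure Y = G → Nat.card ι ≤ Y.ncard) :
    (∀ p, letter f p ≠ 1) ∧ ∀ p q : ι × Bool, p.1 ≠ q.1 → letter f p ≠ letter f q := by
  constructor
  · intro p hp
    apply not_redundant f hf hmin p.1
    rw [← letter_mem, hp]
    exact one_mem _
  · intro p q hpq he
    apply not_redundant f hf hmin p.1
    rw [← letter_mem, he, letter_mem]
    exact Subgroup.subset_closure ⟨q.1, hpq.symm, rfl⟩

lemma main_red (hT : T.IsTree) [LinearOrder V] {α : Type*} [LinearOrder α] [WellFoundedLT α]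
    {key : (T ≃g T) → α} (hkey : GoodKey T v0 key) {G : Subgroup (T ≃g T)}
    (hG : PurelyHyperbolic T G) [Finite ι] (f0 : FreeGroup ι →* (T ≃g T)) (h0 : f0.range = G)
    (hmin : ∀ Y : Set (T ≃g T), Y.Finite → Subgroup.closure Y = G → Nat.card ι ≤ Y.ncard) :
    ∃ e : FreeGroup ι ≃* FreeGroup ι, (f0.comp e.toMonoidHom).range = G ∧
      ∀ p q : ι × Bool, (p.1 = q.1 → p.2 = q.2) →
        key (letter (f0.comp e.toMonoidHom) p) <
          key (letter (f0.comp e.toMonoidHom) p * letter (f0.comp e.toMonoidHom) q) := by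
  classical
  obtain ⟨_, ⟨e, rfl⟩, hm⟩ := WellFounded.has_min (wellFounded_lt (α := ι → α))
    (Set.range fun e : FreeGroup ι ≃* FreeGroup ι => fun i => key (f0 (e (FreeGroup.of i))))
    ⟨_, ⟨MulEquiv.refl _, rfl⟩⟩
  refine ⟨e, ?_⟩
  have hr : (f0.comp e.toMonoidHom).range = G := by
    rw [← h0]
    ext g
    simp only [MonoidHom.mem_range]
    constructor
    · rintro ⟨x, rfl⟩
      exact ⟨e x, rfl⟩
    · rintro ⟨x, rfl⟩
      exact ⟨e.symm x, by simp⟩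
  refine ⟨hr, ?_⟩
  set f := f0.comp e.toMonoidHom with hf
  obtain ⟨hne1, hne⟩ := letter_ne f hr hmin
  have hGm : ∀ p, letter f p ∈ G := by
    intro p
    rw [letter_mem, ← hr]
    exact ⟨_, rfl⟩
  have hhyp : ∀ p, ¬ IsElliptic T (letter f p) := fun p => hG _ (hGm p) (hne1 p)
  have hM : ∀ (i j : ι), j ≠ i → ∀ m n : ℤ, key (f (FreeGroup.of i)) ≤
      key (f (FreeGroup.of j) ^ m * f (FreeGroup.of i) * f (FreeGroup.of j) ^ n) := by
    intro i j hij m n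
    by_contra hcon
    rw [not_le] at hcon
    apply hm _ ⟨(niel hij m n).trans e, rfl⟩
    have hval : ∀ k, f0 (((niel hij m n).trans e) (FreeGroup.of k)) =
        if k = i then f (FreeGroup.of j) ^ m * f (FreeGroup.of i) * f (FreeGroup.of j) ^ n
        else f (FreeGroup.of k) := by
      intro k
      by_cases hk : k = i
      · subst hk
        simp [niel, nielHom, hf]
      · simp [niel, nielHom, hk, hf]
    rw [Pi.lt_def]
    constructor
    · intro k
      simp only [hval]
      by_cases hk : k = i
      · subst hk
        rw [if_pos rfl]
        exact hcon.le
      · rw [if_neg hk]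
        exact le_rfl
    · refine ⟨i, ?_⟩
      simp only [hval, if_true]
      exact hcon
  have hle : ∀ p q : ι × Bool, p.1 ≠ q.1 →
      key (letter f p) ≤ key (letter f p * letter f q) := by
    rintro ⟨i, b⟩ ⟨j, c⟩ hij
    simp only at hij
    cases b
    · have h1 : key (letter f (i, false)) = key (f (FreeGroup.of i)) := by
        simp [letter, hkey.inv]
      have h2 : key (letter f (i, false) * letter f (j, c)) =
          key (letter f (j, !c) * f (FreeGroup.of i)) := by
        rw [← hkey.inv, mul_inv_rev, letter_inv, letter_inv]
        simp [letter]
      rw [h1, h2]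
      cases c
      · simpa [letter] using hM i j hij.symm 1 0
      · simpa [letter] using hM i j hij.symm (-1) 0
    · cases c
      · simpa [letter] using hM i j hij.symm 0 (-1)
      · simpa [letter] using hM i j hij.symm 0 1
  have hle' : ∀ p q : ι × Bool, p.1 ≠ q.1 →
      key (letter f q) ≤ key (letter f p * letter f q) := by
    rintro ⟨i, b⟩ ⟨j, c⟩ hij
    have := hle (j, !c) (i, !b) (Ne.symm hij)
    rwa [← letter_inv, ← letter_inv, ← mul_inv_rev, hkey.inv, hkey.inv] at this
  rintro p q hpq
  by_cases hi : p.1 = q.1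
  · have : p = q := Prod.ext hi (hpq hi)
    subst this
    apply hkey.lt
    by_contra hcon
    exact hhyp p (sq_elliptic hT _ (not_lt.1 hcon))
  · rcases lt_or_eq_of_le (hle p q hi) with h | h
    · exact h
    · exfalso
      have hn : nrm T v0 (letter f p * letter f q) = nrm T v0 (letter f p) := by
        rcases lt_trichotomy (nrm T v0 (letter f p * letter f q)) (nrm T v0 (letter f p))
          with h1 | h1 | h1
        · exact absurd h.symm (hkey.lt _ _ h1).ne
        · exact h1
        · exact absurd h (hkey.lt _ _ h1).ne
      by_cases hq : nrm T v0 (letter f q) ≤ nrm T v0 (letter f p)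
      · exact hhyp q (tie_elliptic hT hn hq (hkey.eq _ _ h (half_mul hT hn hq)))
      · exact absurd (hle' p q hi) (not_le.2 (hkey.lt _ _ (by omega)))

lemma GoodKey.nrm_le [LinearOrder V] {α : Type*} [LinearOrder α] {key : (T ≃g T) → α}
    (hkey : GoodKey T v0 key) {g h : T ≃g T} (hl : key g ≤ key h) : nrm T v0 g ≤ nrm T v0 h := by
  by_contra hcon
  exact absurd hl (not_le.2 (hkey.lt _ _ (not_le.1 hcon)))

lemma inj_of_key1 (hT : T.IsTree) [LinearOrder V]
    (hlt : IsPathOrder T v0 (fun a b : V => a < b)) {G : Subgroup (T ≃g T)}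
    (hG : PurelyHyperbolic T G) [Finite ι] (f : FreeGroup ι →* (T ≃g T)) (hr : f.range = G)
    (hmin : ∀ Y : Set (T ≃g T), Y.Finite → Subgroup.closure Y = G → Nat.card ι ≤ Y.ncard)
    (hk : ∀ p q : ι × Bool, (p.1 = q.1 → p.2 = q.2) →
        key1 T v0 (letter f p) < key1 T v0 (letter f p * letter f q)) :
    Function.Injective f := by
  classical
  obtain ⟨hne1, hne⟩ := letter_ne f hr hmin
  have hGm : ∀ p, letter f p ∈ G := by
    intro p
    rw [letter_mem, ← hr]
    exact ⟨_, rfl⟩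
  have hhyp : ∀ p, ¬ IsElliptic T (letter f p) := fun p => hG _ (hGm p) (hne1 p)
  have hpos : ∀ p, 0 < nrm T v0 (letter f p) := by
    intro p
    by_contra hcon
    apply hhyp p
    left
    refine ⟨v0, ?_⟩
    have : T.dist v0 (letter f p v0) = 0 := by
      change nrm T v0 (letter f p) = 0
      omega
    exact ((hT.connected.dist_eq_zero_iff).1 this).symm
  have n1 : ∀ p q : ι × Bool, (p.1 = q.1 → p.2 = q.2) →
      nrm T v0 (letter f p) ≤ nrm T v0 (letter f p * letter f q) :=
    fun p q h => good_key1.nrm_le (hk p q h).le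
  have hsymm : ∀ {p q : ι × Bool}, (p.1 = q.1 → p.2 = q.2) →
      (((q.1, !q.2) : ι × Bool).1 = ((p.1, !p.2) : ι × Bool).1 →
        ((q.1, !q.2) : ι × Bool).2 = ((p.1, !p.2) : ι × Bool).2) := by
    intro p q h h'
    simp only at h' ⊢
    rw [h h'.symm]
  have hmulinv : ∀ p q : ι × Bool, letter f (q.1, !q.2) * letter f (p.1, !p.2) =
      (letter f p * letter f q)⁻¹ := by
    intro p q
    rw [mul_inv_rev, ← letter_inv, ← letter_inv]
  have hli : ∀ p : ι × Bool, letter f (p.1, !p.2) = (letter f p)⁻¹ := by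
    intro p
    rw [← letter_inv]
  have n2 : ∀ p q : ι × Bool, (p.1 = q.1 → p.2 = q.2) →
      nrm T v0 (letter f q) ≤ nrm T v0 (letter f p * letter f q) := by
    intro p q h
    have := n1 _ _ (hsymm h)
    rwa [hmulinv, hli, nrm_inv, nrm_inv] at this
  have ho : ∀ p q : ι × Bool, (p.1 = q.1 → p.2 = q.2) →
      nrm T v0 (letter f p * letter f q) = nrm T v0 (letter f p) →
      halfVertex T v0 (letter f q) < halfVertex T v0 (letter f q)⁻¹ := by
    intro p q h hn
    have hq : nrm T v0 (letter f q) ≤ nrm T v0 (letter f p) := hn ▸ n2 p q h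
    exact order_half hT hlt hn hq (hhyp q) (key1_le (hk p q h).le hn.symm (half_mul hT hn hq))
  have n3 : ∀ p q r : ι × Bool, (p.1 = q.1 → p.2 = q.2) → (q.1 = r.1 → q.2 = r.2) →
      nrm T v0 (letter f p) + nrm T v0 (letter f r) <
        nrm T v0 (letter f p * letter f q) + nrm T v0 (letter f q * letter f r) := by
    intro p q r hpq hqr
    by_contra hcon
    have a1 := n1 p q hpq
    have a2 := n2 q r hqr
    have b1 := ho p q hpq (by omega)
    have b2 := ho _ _ (hsymm hqr) (by rw [hmulinv, hli, nrm_inv, nrm_inv]; omega)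
    rw [hli, inv_inv] at b2
    exact lt_asymm b1 b2
  rw [injective_iff_map_eq_one]
  intro x hx
  rw [← FreeGroup.toWord_eq_nil_iff]
  rcases hw : x.toWord with _ | ⟨l, L⟩
  · rfl
  · exfalso
    have hred : FreeGroup.IsReduced (l :: L) := hw ▸ FreeGroup.isReduced_toWord
    have h1 := (word_pos (v0 := v0) hT (letter f) hpos n2 n3 L l hred).1
    rw [← hom_mk, ← hw, FreeGroup.mk_toWord, hx, nrm_one] at h1
    omega

lemma final_hyp (hT : T.IsTree) [LinearOrder V] [WellFoundedLT V]
    (hlt : IsPathOrder T v0 (fun a b : V => a < b)) (X : Set (T ≃g T)) (hX : X.Finite)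
    (hG : PurelyHyperbolic T (Subgroup.closure X)) :
    ∃ X' : Set (T ≃g T), X'.Finite ∧ Subgroup.closure X' = Subgroup.closure X ∧
        StronglyNReduced T v0 (fun a b : V => a < b) X' := by
  classical
  obtain ⟨Y, ⟨hYf, hYc⟩, hYmin⟩ := WellFounded.has_min
    (InvImage.wf (fun Y : Set (T ≃g T) => Y.ncard) (wellFounded_lt (α := ℕ)))
    {Y : Set (T ≃g T) | Y.Finite ∧ Subgroup.closure Y = Subgroup.closure X} ⟨X, hX, rfl⟩
  have : Finite Y := hYf
  have hmin : ∀ Z : Set (T ≃g T), Z.Finite → Subgroup.closure Z = Subgroup.closure X →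
      Nat.card Y ≤ Z.ncard := by
    intro Z h1 h2
    have := hYmin Z ⟨h1, h2⟩
    simp only [InvImage, not_lt] at this
    exact this
  let f0 : FreeGroup Y →* (T ≃g T) := FreeGroup.lift (fun y : Y => (y : T ≃g T))
  have h0 : f0.range = Subgroup.closure X := by
    rw [range_eq_closure, ← hYc]
    simp [f0]
  obtain ⟨e1, hr1, hk1⟩ := main_red (v0 := v0) hT good_key1 hG f0 h0 hmin
  have hinj1 := inj_of_key1 hT hlt hG _ hr1 hmin hk1
  obtain ⟨e2, hr2, hk2⟩ := main_red (v0 := v0) hT good_key2 hG _ hr1 hmin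
  have hinj2 : Function.Injective ((f0.comp e1.toMonoidHom).comp e2.toMonoidHom) :=
    hinj1.comp e2.injective
  set f := (f0.comp e1.toMonoidHom).comp e2.toMonoidHom
  obtain ⟨hne1, hne⟩ := letter_ne f hr2 hmin
  have hcl : Subgroup.closure (Set.range fun k => f (FreeGroup.of k)) = Subgroup.closure X := by
    rw [← range_eq_closure, hr2]
  have hxpm : ∀ x ∈ Xpm T (Set.range fun k => f (FreeGroup.of k)), ∃ p, x = letter f p := by
    rintro x (⟨k, rfl⟩ | ⟨k, hk⟩)
    · exact ⟨(k, true), rfl⟩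
    · refine ⟨(k, false), ?_⟩
      simp only at hk
      simp [letter, hk]
  refine ⟨Set.range fun k => f (FreeGroup.of k), Set.finite_range _, hcl, ⟨?_, ?_⟩, ?_, ?_⟩
  · have hfi : Function.Injective (fun k => f (FreeGroup.of k)) :=
      hinj2.comp FreeGroup.of_injective
    let E := Equiv.ofInjective _ hfi
    have hcomp : FreeGroup.lift (fun x : (Set.range fun k => f (FreeGroup.of k)) =>
        (x : T ≃g T)) = f.comp (FreeGroup.freeGroupCongr E.symm).toMonoidHom := by
      apply FreeGroup.ext_hom
      intro a
      obtain ⟨k, rfl⟩ := E.surjective a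
      simp [E]
    rw [hcomp]
    exact hinj2.comp (FreeGroup.freeGroupCongr E.symm).injective
  · rw [range_eq_closure]
    simp only [FreeGroup.lift_apply_of, Subtype.range_coe]
  · rw [N1, Set.eq_empty_iff_forall_notMem]
    rintro x ⟨⟨k, rfl⟩, ⟨j, hj⟩⟩
    simp only at hj
    by_cases hkj : k = j
    · subst hkj
      have h1 := good_key2.nrm_le (hk2 (k, true) (k, true) (fun _ => rfl)).le
      have h2 := hk2 (k, true) (k, true) (fun _ => rfl)
      have h3 : letter f (k, true) * letter f (k, true) = 1 := by
        simp only [letter, cond_true]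
        nth_rewrite 1 [hj]
        simp
      have h4 : letter f (k, true) ≠ 1 := hne1 _
      have h5 : f (FreeGroup.of k * FreeGroup.of k) = f 1 := by
        rw [map_mul, map_one]; exact h3
      have h6 := hinj2 h5
      rw [h3] at h2 h1
      rw [nrm_one] at h1
      apply hG _ _ h4
      · left
        refine ⟨v0, ?_⟩
        have : T.dist v0 (letter f (k, true) v0) = 0 := by
          change nrm T v0 (letter f (k, true)) = 0
          omega
        exact ((hT.connected.dist_eq_zero_iff).1 this).symm
      · rw [letter_mem, ← hr2]
        exact ⟨_, rfl⟩
    · exact hne (j, true) (k, false) (Ne.symm hkj) (by simpa [letter] using hj)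
  · intro x hx y hy hxy
    obtain ⟨p, rfl⟩ := hxpm x hx
    obtain ⟨q, rfl⟩ := hxpm y hy
    apply key2_lt
    apply hk2
    intro hpq
    by_contra hb
    apply hxy
    obtain ⟨i, b⟩ := p
    obtain ⟨j, c⟩ := q
    simp only at hpq hb
    subst hpq
    rw [letter_inv]
    congr 2
    cases b <;> cases c <;> simp_all

end Reduction

/-- Nielsen reduction algorithm output (Theorem A). -/
theorem statement_0 {V : Type*} (T : SimpleGraph V) (hT : T.IsTree) (v0 : V)
    (lt : V → V → Prop) (hlt : IsPathOrder T v0 lt)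
    (X : Set (T ≃g T)) (hXfin : X.Finite) :
    (∃ X' : Set (T ≃g T), X'.Finite ∧ Subgroup.closure X' = Subgroup.closure X ∧
      ((∃ x ∈ X', x ≠ 1 ∧ IsElliptic T x) ∨ StronglyNReduced T v0 lt X')) ∧
    (PurelyHyperbolic T (Subgroup.closure X) →
      ∃ X' : Set (T ≃g T), X'.Finite ∧ Subgroup.closure X' = Subgroup.closure X ∧
        StronglyNReduced T v0 lt X') := by
  classical
  have h2 : PurelyHyperbolic T (Subgroup.closure X) →
      ∃ X' : Set (T ≃g T), X'.Finite ∧ Subgroup.closure X' = Subgroup.closure X ∧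
        StronglyNReduced T v0 lt X' := by
    intro hG
    haveI := hlt.wellOrder
    letI : LinearOrder V := linearOrderOfSTO lt
    haveI : WellFoundedLT V := ⟨hlt.wellOrder.wf⟩
    exact final_hyp hT hlt X hXfin hG
  refine ⟨?_, h2⟩
  by_cases hG : PurelyHyperbolic T (Subgroup.closure X)
  · obtain ⟨X', h1, h3, h4⟩ := h2 hG
    exact ⟨X', h1, h3, Or.inr h4⟩
  · simp only [PurelyHyperbolic, IsHyperbolic, not_forall, not_not] at hG
    obtain ⟨g, hg, hg1, hell⟩ := hG
    refine ⟨insert g X, hXfin.insert g, ?_, Or.inl ⟨g, Set.mem_insert _ _, hg1, hell⟩⟩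
    apply le_antisymm
    · rw [Subgroup.closure_le]
      exact Set.insert_subset hg Subgroup.subset_closure
    · exact Subgroup.closure_mono (Set.subset_insert _ _)

end TreePaper

end
end

section
/- Let X ⊆ Aut(T) be a finite set of hyperbolic automorphisms with X ∩ X⁻¹ = ∅ (no nontrivial elliptic elements, condition N1). Then X admits a fundamental system if and only if for all g, h ∈ X^± with g ≠ h⁻¹, [v0, h·v0] < [v0, gh·v0]. -/
noncomputable section

open Pointwise

namespace TreePaper

variable {V : Type*}

section TreeMetric

variable {T : SimpleGraph V}

theorem dtri (hT : T.IsTree) (a b c : V) : T.dist a c ≤ T.dist a b + T.dist b c :=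
  hT.connected.dist_triangle

theorem dcomm (a b : V) : T.dist a b = T.dist b a := SimpleGraph.dist_comm

theorem deq (hT : T.IsTree) {a b : V} (h : T.dist a b = 0) : a = b :=
  hT.connected.dist_eq_zero_iff.1 h

theorem iso_dist_le (hT : T.IsTree) (g : T ≃g T) (a b : V) :
    T.dist (g a) (g b) ≤ T.dist a b := by
  obtain ⟨p, hp⟩ := hT.connected.exists_walk_length_eq_dist a b
  have := SimpleGraph.dist_le (p.map g.toHom)
  rw [SimpleGraph.Walk.length_map, hp] at this
  exact this

theorem iso_dist (hT : T.IsTree) (g : T ≃g T) (a b : V) :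
    T.dist (g a) (g b) = T.dist a b := by
  apply le_antisymm (iso_dist_le hT g a b)
  have := iso_dist_le hT g⁻¹ (g a) (g b)
  simpa using this

theorem mem_support_seg (hT : T.IsTree) {u v x : V} (p : T.Walk u v)
    (hp : p.length = T.dist u v) (hx : x ∈ p.support) :
    T.dist u x + T.dist x v = T.dist u v := by
  obtain ⟨q, r, rfl⟩ := SimpleGraph.Walk.mem_support_iff_exists_append.1 hx
  have h1 := SimpleGraph.dist_le q
  have h2 := SimpleGraph.dist_le r
  have h3 := dtri hT u x v
  rw [SimpleGraph.Walk.length_append] at hp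
  omega

theorem path_length (hT : T.IsTree) {u v : V} (p : T.Walk u v) (hp : p.IsPath) :
    p.length = T.dist u v := by
  obtain ⟨q, hq, hq'⟩ := hT.connected.exists_path_of_dist u v
  rw [(hT.existsUnique_path u v).unique hp hq, hq']

/-- point at given distance -/
theorem exists_at (hT : T.IsTree) (u v : V) (t : ℕ) (ht : t ≤ T.dist u v) :
    ∃ x, T.dist u x = t ∧ T.dist u x + T.dist x v = T.dist u v := by
  obtain ⟨p, hp⟩ := hT.connected.exists_walk_length_eq_dist u v
  refine ⟨p.getVert t, ?_, mem_support_seg hT p hp (p.getVert_mem_support t)⟩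
  have h1 := SimpleGraph.dist_le (p.take t)
  have h2 := SimpleGraph.dist_le (p.drop t)
  have h3 := dtri hT u (p.getVert t) v
  rw [SimpleGraph.Walk.take_length] at h1
  rw [SimpleGraph.Walk.drop_length] at h2
  omega

theorem btw (hT : T.IsTree) {x y m n : V} (hm : T.dist x m + T.dist m y = T.dist x y)
    (hn : T.dist x n + T.dist n y = T.dist x y) :
    T.dist x n + T.dist n m = T.dist x m ∨ T.dist m n + T.dist n y = T.dist m y := by
  obtain ⟨p, hp⟩ := hT.connected.exists_walk_length_eq_dist x m
  obtain ⟨q, hq⟩ := hT.connected.exists_walk_length_eq_dist m y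
  obtain ⟨p', hp'⟩ := hT.connected.exists_walk_length_eq_dist x n
  obtain ⟨q', hq'⟩ := hT.connected.exists_walk_length_eq_dist n y
  have h1 : (p.append q).IsPath := by
    apply SimpleGraph.Walk.isPath_of_length_eq_dist
    rw [SimpleGraph.Walk.length_append]; omega
  have h2 : (p'.append q').IsPath := by
    apply SimpleGraph.Walk.isPath_of_length_eq_dist
    rw [SimpleGraph.Walk.length_append]; omega
  have h3 := (hT.existsUnique_path x y).unique h1 h2
  have h4 : n ∈ (p.append q).support := by
    rw [h3, SimpleGraph.Walk.mem_support_append_iff]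
    left; simp
  rw [SimpleGraph.Walk.mem_support_append_iff] at h4
  rcases h4 with h4 | h4
  · left; exact mem_support_seg hT p hp h4
  · right; exact mem_support_seg hT q hq h4

theorem gate_aux (hT : T.IsTree) {A : Set V}
    (hA : ∀ a ∈ A, ∀ b ∈ A, ∀ x, T.dist a x + T.dist x b = T.dist a b → x ∈ A)
    {z p a : V} (hp : p ∈ A) (hmin : ∀ b ∈ A, T.dist z p ≤ T.dist z b) (ha : a ∈ A) :
    T.dist z a = T.dist z p + T.dist p a := by
  obtain ⟨P, hP⟩ := hT.connected.exists_walk_length_eq_dist z p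
  obtain ⟨Q, hQ⟩ := hT.connected.exists_walk_length_eq_dist p a
  have hPp := SimpleGraph.Walk.isPath_of_length_eq_dist P hP
  have hQp := SimpleGraph.Walk.isPath_of_length_eq_dist Q hQ
  have h1 : (P.append Q).IsPath := by
    rw [SimpleGraph.Walk.isPath_def, SimpleGraph.Walk.support_append, List.nodup_append]
    refine ⟨hPp.support_nodup, hQp.support_nodup.tail, ?_⟩
    rintro x hx y hy rfl
    have hxA : x ∈ A := hA p hp a ha x (mem_support_seg hT Q hQ (List.mem_of_mem_tail hy))
    have h2 := mem_support_seg hT P hP hx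
    have h3 := hmin x hxA
    have h4 : x = p := deq hT (by omega)
    subst h4
    have h5 := hQp.support_nodup
    rw [← SimpleGraph.Walk.cons_tail_support] at h5
    exact (List.nodup_cons.1 h5).1 hy
  have := path_length hT _ h1
  rw [SimpleGraph.Walk.length_append] at this
  omega

theorem seg_convex (hT : T.IsTree) {u w a b x : V} (ha : T.dist u a + T.dist a w = T.dist u w)
    (hb : T.dist u b + T.dist b w = T.dist u w) (hx : T.dist a x + T.dist x b = T.dist a b) :
    T.dist u x + T.dist x w = T.dist u w := by
  have h1 := dtri hT u a x
  have h2 := dtri hT x a w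
  have h3 := dtri hT u b x
  have h4 := dtri hT x b w
  have h5 := dtri hT u x w
  have e1 := dcomm (T := T) a x
  have e2 := dcomm (T := T) a b
  have e3 := dcomm (T := T) b x
  rcases btw hT ha hb with h | h <;> omega

/-- median -/
theorem exists_median (hT : T.IsTree) (u v w : V) :
    ∃ m, T.dist v m + T.dist m w = T.dist v w ∧ T.dist u m + T.dist m v = T.dist u v ∧
      T.dist u m + T.dist m w = T.dist u w := by
  classical
  let A : Set V := {x | T.dist v x + T.dist x w = T.dist v w}
  have hA : ∀ a ∈ A, ∀ b ∈ A, ∀ x, T.dist a x + T.dist x b = T.dist a b → x ∈ A :=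
    fun a ha b hb x hx => seg_convex hT ha hb hx
  have hv : v ∈ A := by simp [A]
  have hw : w ∈ A := by simp [A]
  let f : V → ℕ := fun x => T.dist u x
  obtain ⟨m, hm, hmin⟩ : ∃ m ∈ A, ∀ b ∈ A, f m ≤ f b := by
    have := Function.argminOn_mem f A ⟨v, hv⟩
    exact ⟨_, this, fun b hb => Function.argminOn_le f A hb⟩
  refine ⟨m, hm, ?_, ?_⟩
  · exact (gate_aux hT hA hm hmin hv).symm
  · exact (gate_aux hT hA hm hmin hw).symm

theorem two_on (hT : T.IsTree) {x y m n : V} (hm : T.dist x m + T.dist m y = T.dist x y)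
    (hn : T.dist x n + T.dist n y = T.dist x y) :
    T.dist m n = (T.dist x m - T.dist x n) + (T.dist x n - T.dist x m) := by
  have e1 := dcomm (T := T) m n
  rcases btw hT hm hn with h | h <;> omega

/-- four point condition -/
theorem four (hT : T.IsTree) (x y z w : V) :
    T.dist x y + T.dist z w ≤ max (T.dist x z + T.dist y w) (T.dist x w + T.dist y z) := by
  obtain ⟨m, h1, h2, h3⟩ := exists_median hT w x y
  obtain ⟨n, h4, h5, h6⟩ := exists_median hT z x y
  have h7 := two_on hT h1 h4
  have h8 := dtri hT z n w
  have h9 := dtri hT n m w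
  have e1 := dcomm (T := T) m n
  have e2 := dcomm (T := T) m w
  have e3 := dcomm (T := T) n x
  have e4 := dcomm (T := T) m x
  have e5 := dcomm (T := T) z x
  have e6 := dcomm (T := T) w x
  have e7 := dcomm (T := T) z y
  have e8 := dcomm (T := T) w y
  rw [le_max_iff]
  omega

end TreeMetric

section Axis

variable {T : SimpleGraph V}

theorem tl_le (g : T ≃g T) (v : V) : tl T g ≤ T.dist v (g v) :=
  Nat.sInf_le ⟨v, rfl⟩

theorem axis_nonempty (hT : T.IsTree) (g : T ≃g T) : ∃ v, v ∈ axisSet T g := by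
  have := hT.connected.nonempty
  obtain ⟨v, hv⟩ := Nat.sInf_mem (Set.range_nonempty fun v : V => T.dist v (g v))
  exact ⟨v, hv⟩

theorem dist_inv (hT : T.IsTree) (g : T ≃g T) (a b : V) :
    T.dist a (g⁻¹ b) = T.dist (g a) b := by
  rw [← iso_dist hT g a (g⁻¹ b), RelIso.apply_inv_self]

theorem dist_self_inv (hT : T.IsTree) (g : T ≃g T) (v : V) :
    T.dist v (g⁻¹ v) = T.dist v (g v) := by
  rw [dist_inv hT, dcomm]

theorem tl_inv (hT : T.IsTree) (g : T ≃g T) : tl T g⁻¹ = tl T g := by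
  unfold tl
  congr 2
  funext v
  exact dist_self_inv hT g v

theorem axis_inv (hT : T.IsTree) (g : T ≃g T) : axisSet T g⁻¹ = axisSet T g := by
  ext v
  simp only [axisSet, Set.mem_ofPred_eq, tl_inv hT, dist_self_inv hT]

theorem hyp_inv {g : T ≃g T} (hg : IsHyperbolic T g) : IsHyperbolic T g⁻¹ := by
  rintro (⟨v, hv⟩ | ⟨u, w, h, h1, h2⟩)
  · apply hg; left; refine ⟨v, ?_⟩
    conv_lhs => rw [← hv]
    simp
  · apply hg; right; refine ⟨u, w, h, ?_, ?_⟩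
    · rw [← h2]; simp
    · rw [← h1]; simp

theorem tl_pos (hT : T.IsTree) {g : T ≃g T} (hg : IsHyperbolic T g) : 0 < tl T g := by
  obtain ⟨v, hv⟩ := axis_nonempty hT g
  rcases Nat.eq_zero_or_pos (tl T g) with h | h
  · exfalso; apply hg; left
    refine ⟨v, (deq hT ?_).symm⟩
    rw [hv, h]
  · exact h

theorem axis_map (hT : T.IsTree) (g : T ≃g T) {v : V} (hv : v ∈ axisSet T g) :
    g v ∈ axisSet T g := by
  simp only [axisSet, Set.mem_ofPred_eq] at *
  rw [iso_dist hT, hv]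

theorem axis_map_inv (hT : T.IsTree) (g : T ≃g T) {v : V} (hv : v ∈ axisSet T g) :
    g⁻¹ v ∈ axisSet T g := by
  rw [← axis_inv hT] at *
  exact axis_map hT _ hv

theorem axis_convex (hT : T.IsTree) (g : T ≃g T) : ∀ a ∈ axisSet T g, ∀ b ∈ axisSet T g, ∀ x,
    T.dist a x + T.dist x b = T.dist a b → x ∈ axisSet T g := by
  intro a ha b hb x hx
  simp only [axisSet, Set.mem_ofPred_eq] at *
  apply le_antisymm _ (tl_le g x)
  have e1 := iso_dist hT g a x
  have e2 := iso_dist hT g x b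
  have e3 := iso_dist hT g a b
  have f1 := four hT x (g x) a b
  have f2 := four hT (g x) b (g a) (g b)
  have f3 := four hT (g x) a (g b) (g a)
  have t1 := dtri hT b a (g a)
  have t2 := dtri hT a b (g b)
  have c1 := dcomm (T := T) a b
  have c2 := dcomm (T := T) a x
  have c3 := dcomm (T := T) (g a) (g x)
  have c4 := dcomm (T := T) (g a) (g b)
  omega

/-- the points `g⁻¹p, p, gp` of the axis are aligned -/
theorem axis_double (hT : T.IsTree) {g : T ≃g T} (hg : IsHyperbolic T g) {p : V}
    (hp : p ∈ axisSet T g) : T.dist p (g (g p)) = 2 * tl T g := by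
  have hl := tl_pos hT hg
  have hp1 : T.dist p (g p) = tl T g := hp
  have hp2 : T.dist (g p) (g (g p)) = tl T g := axis_map hT g hp
  obtain ⟨m, h1, h2, h3⟩ := exists_median hT (g p) p (g (g p))
  have c1 := dcomm (T := T) p (g p)
  by_cases ht : T.dist (g p) m = 0
  · have c := dcomm (T := T) p m
    omega
  exfalso
  obtain ⟨a, ha1, ha2⟩ := exists_at hT (g p) m 1 (by omega)
  obtain ⟨x, hx1, hx2⟩ := exists_at hT p (g p) 1 (by omega)
  have t1 := dtri hT a m p
  have t2 := dtri hT a m (g (g p))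
  have t3 := dtri hT (g p) a p
  have t4 := dtri hT (g p) a (g (g p))
  have ha3 : T.dist (g p) a + T.dist a p = T.dist (g p) p := by omega
  have ha4 : T.dist (g p) a + T.dist a (g (g p)) = T.dist (g p) (g (g p)) := by omega
  have e1 := iso_dist hT g p x
  have e2 := iso_dist hT g x (g p)
  have e3 := iso_dist hT g p (g p)
  have hxa : g x = a := by
    apply deq hT
    rw [two_on hT (x := g p) (y := g (g p)) (m := g x) (n := a) (by omega) ha4]
    omega
  have hmin := tl_le g x
  rw [hxa] at hmin
  have c2 := dcomm (T := T) p a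
  have c3 := dcomm (T := T) (g p) a
  have := two_on hT (x := p) (y := g p) (m := x) (n := a) hx2 (by omega)
  have hl1 : tl T g = 1 := by omega
  have hx3 : x = g p := deq hT (by omega)
  have ha5 : a = p := deq hT (by omega)
  apply hg
  right
  refine ⟨p, g p, ?_, rfl, ?_⟩
  · rw [← SimpleGraph.dist_eq_one_iff_adj]; omega
  · rw [← hx3, hxa, ha5]

theorem line_aux (hT : T.IsTree) {g : T ≃g T} {a b : V}
    (ha : a ∈ axisSet T g) (hb : b ∈ axisSet T g)
    (h : T.dist a (g b) = T.dist a b + tl T g) :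
    T.dist a (g⁻¹ b) = (T.dist a b - tl T g) + (tl T g - T.dist a b) := by
  have ha1 : T.dist a (g a) = tl T g := ha
  have hb1 : T.dist b (g b) = tl T g := hb
  have e := iso_dist hT g a b
  rw [dist_inv hT, dcomm]
  rw [two_on hT (x := a) (y := g b) (m := b) (n := g a) (by omega) (by omega)]
  omega

theorem line (hT : T.IsTree) {g : T ≃g T} (hg : IsHyperbolic T g) {a b : V}
    (ha : a ∈ axisSet T g) (hb : b ∈ axisSet T g) :
    (T.dist a (g b) = T.dist a b + tl T g ∧
      T.dist a (g⁻¹ b) = (T.dist a b - tl T g) + (tl T g - T.dist a b)) ∨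
    (T.dist a (g⁻¹ b) = T.dist a b + tl T g ∧
      T.dist a (g b) = (T.dist a b - tl T g) + (tl T g - T.dist a b)) := by
  have hb1 : T.dist b (g b) = tl T g := hb
  have hb2 := dist_self_inv hT g b
  have h2 := axis_double hT hg (axis_map_inv hT g hb)
  rw [RelIso.apply_inv_self] at h2
  have f := four hT a b (g⁻¹ b) (g b)
  have t1 := dtri hT a b (g b)
  have t2 := dtri hT a b (g⁻¹ b)
  by_cases h : T.dist a (g b) = T.dist a b + tl T g
  · left; exact ⟨h, line_aux hT ha hb h⟩
  · right
    have h' : T.dist a (g⁻¹ b) = T.dist a b + tl T g := by omega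
    refine ⟨h', ?_⟩
    have := line_aux hT (g := g⁻¹) (a := a) (b := b) (by rwa [axis_inv hT]) (by rwa [axis_inv hT])
      (by rwa [tl_inv hT])
    rwa [inv_inv, tl_inv hT] at this

theorem exists_near (hT : T.IsTree) (g : T ≃g T) (z : V) :
    ∃ p, NearestPt T (axisSet T g) z p := by
  classical
  obtain ⟨v, hv⟩ := axis_nonempty hT g
  let f : V → ℕ := fun x => T.dist z x
  exact ⟨_, Function.argminOn_mem f _ ⟨v, hv⟩, fun b hb => Function.argminOn_le f _ hb⟩

theorem gate (hT : T.IsTree) {g : T ≃g T} {z p a : V} (hp : NearestPt T (axisSet T g) z p)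
    (ha : a ∈ axisSet T g) : T.dist z a = T.dist z p + T.dist p a :=
  gate_aux hT (axis_convex hT g) hp.1 hp.2 ha

theorem near_unique (hT : T.IsTree) {g : T ≃g T} {z p q : V}
    (hp : NearestPt T (axisSet T g) z p) (hq : NearestPt T (axisSet T g) z q) : p = q := by
  have h1 := gate hT hp hq.1
  have h2 := hq.2 p hp.1
  exact deq hT (by omega)

theorem near_self {g : T ≃g T} {z : V} (hz : z ∈ axisSet T g) :
    NearestPt T (axisSet T g) z z := ⟨hz, fun a _ => by simp⟩

theorem near_map (hT : T.IsTree) {g : T ≃g T} {z p : V}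
    (hp : NearestPt T (axisSet T g) z p) : NearestPt T (axisSet T g) (g z) (g p) := by
  refine ⟨axis_map hT g hp.1, fun a ha => ?_⟩
  rw [iso_dist hT]
  have := hp.2 _ (axis_map_inv hT g ha)
  rwa [dist_inv hT] at this

theorem near_map_inv (hT : T.IsTree) {g : T ≃g T} {z p : V}
    (hp : NearestPt T (axisSet T g) z p) : NearestPt T (axisSet T g) (g⁻¹ z) (g⁻¹ p) := by
  rw [← axis_inv hT] at *
  exact near_map hT hp

theorem near_btw (hT : T.IsTree) {g : T ≃g T} {z p x : V}
    (hp : NearestPt T (axisSet T g) z p) (hx : T.dist z x + T.dist x p = T.dist z p) :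
    NearestPt T (axisSet T g) x p := by
  refine ⟨hp.1, fun a ha => ?_⟩
  have h1 := hp.2 a ha
  have h2 := dtri hT z x a
  omega

theorem through (hT : T.IsTree) {g : T ≃g T} {x y p q : V}
    (hp : NearestPt T (axisSet T g) x p) (hq : NearestPt T (axisSet T g) y q) (hpq : p ≠ q) :
    T.dist x y = T.dist x p + T.dist p q + T.dist y q := by
  have h1 := gate hT hp hq.1
  have h2 := gate hT hq hp.1
  have h3 := hT.connected.pos_dist_of_ne hpq
  have h4 := four hT x q y p
  have t1 := dtri hT x q y
  have c1 := dcomm (T := T) q p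
  have c2 := dcomm (T := T) q y
  have c3 := dcomm (T := T) p y
  omega

theorem through_le (hT : T.IsTree) (x y p q : V) :
    T.dist x y ≤ T.dist x p + T.dist p q + T.dist y q := by
  have t1 := dtri hT x q y
  have t2 := dtri hT x p q
  have c2 := dcomm (T := T) q y
  omega

theorem proj_btw (hT : T.IsTree) {g : T ≃g T} {a b x pa pb px : V}
    (ha : NearestPt T (axisSet T g) a pa) (hb : NearestPt T (axisSet T g) b pb)
    (hx : NearestPt T (axisSet T g) x px) (h : T.dist a x + T.dist x b = T.dist a b) :
    T.dist pa px + T.dist px pb = T.dist pa pb := by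
  by_cases h1 : pa = px
  · subst h1; simp
  by_cases h2 : px = pb
  · subst h2; simp
  have h3 := through hT ha hx h1
  have h4 := through hT hx hb h2
  have h5 := through_le hT a b pa pb
  have h6 := dtri hT pa px pb
  omega

/-- position of a point of the axis relative to `c, gc, g⁻¹c` -/
theorem axis_pos (hT : T.IsTree) {g : T ≃g T} (hg : IsHyperbolic T g) {c z : V}
    (hc : c ∈ axisSet T g) (hz : z ∈ axisSet T g) :
    (T.dist z (g c) = (T.dist c z - tl T g) + (tl T g - T.dist c z)) ∨
    (T.dist z (g⁻¹ c) = (T.dist c z - tl T g) + (tl T g - T.dist c z)) := by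
  rw [dcomm c z]
  rcases line hT hg hz hc with h | h
  · right; exact h.2
  · left; exact h.2

theorem opp_aux (hT : T.IsTree) {g : T ≃g T} {c p p' : V}
    (hc : c ∈ axisSet T g)
    (h1 : 2 * T.dist c p = tl T g) (h2 : 2 * T.dist c p' = tl T g)
    (h3 : T.dist p (g c) = T.dist c p) (h4 : T.dist p' (g⁻¹ c) = T.dist c p) :
    p' = g⁻¹ p := by
  have hc1 : T.dist c (g c) = tl T g := hc
  rw [dist_inv hT] at h4
  have e := iso_dist hT g c p'
  have c1 := dcomm (T := T) (g p') c
  have c2 := dcomm (T := T) (g c) (g p')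
  have : T.dist p (g p') = 0 := by
    rw [two_on hT (x := c) (y := g c) (m := p) (n := g p') (by omega) (by omega)]
    omega
  rw [deq hT this]; simp

theorem opp (hT : T.IsTree) {g : T ≃g T} (hg : IsHyperbolic T g) {c p p' : V}
    (hc : c ∈ axisSet T g) (hp : p ∈ axisSet T g) (hp' : p' ∈ axisSet T g)
    (h1 : 2 * T.dist c p = tl T g) (h2 : 2 * T.dist c p' = tl T g) (hne : p' ≠ p) :
    p' = g p ∨ p' = g⁻¹ p := by
  have hc1 : T.dist c (g c) = tl T g := hc
  have hc2 := dist_self_inv hT g c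
  rcases axis_pos hT hg hc hp with h3 | h3 <;> rcases axis_pos hT hg hc hp' with h4 | h4
  · exfalso; apply hne; apply deq hT
    rw [two_on hT (x := c) (y := g c) (m := p') (n := p) (by omega) (by omega)]
    omega
  · right; exact opp_aux hT hc h1 h2 (by omega) (by omega)
  · left
    have := opp_aux hT hc h2 h1 (by omega) (by omega)
    rw [this]; simp
  · exfalso; apply hne; apply deq hT
    rw [two_on hT (x := c) (y := g⁻¹ c) (m := p') (n := p) (by omega) (by omega)]
    omega

end Axis

section Key

variable {T : SimpleGraph V} {v0 : V} {lt : V → V → Prop}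

theorem lt_asymm' (hlt : IsPathOrder T v0 lt) {a b : V} (h : lt a b) (h' : lt b a) : False := by
  have := hlt.wellOrder
  exact asymm_of lt h h'

theorem lt_tri (hlt : IsPathOrder T v0 lt) (a b : V) : lt a b ∨ a = b ∨ lt b a := by
  have := hlt.wellOrder
  exact trichotomous_of lt a b

/-- `w` precedes both `g w` and `g⁻¹ w`. -/
def PP (lt : V → V → Prop) (g : T ≃g T) (w : V) : Prop := lt w (g w) ∧ lt w (g⁻¹ w)

theorem PP_inv (g : T ≃g T) (w : V) : PP lt g⁻¹ w ↔ PP lt g w := by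
  unfold PP
  rw [inv_inv]
  exact and_comm

theorem cmp_lt (hT : T.IsTree) (hlt : IsPathOrder T v0 lt) {g : T ≃g T} {c w w' p p' : V}
    (hc : NearestPt T (axisSet T g) v0 c) (hp : NearestPt T (axisSet T g) w p)
    (hp' : NearestPt T (axisSet T g) w' p') (hd : T.dist w p = T.dist w' p')
    (h : T.dist c p < T.dist c p') : lt w w' := by
  apply hlt.short
  have h1 := through_le hT v0 w c p
  have h2 := through hT hc hp' (by rintro rfl; simp at h)
  omega

theorem cmp_eq (hT : T.IsTree) (hlt : IsPathOrder T v0 lt) {g : T ≃g T} {c w w' p p' : V}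
    (hc : NearestPt T (axisSet T g) v0 c) (hp : NearestPt T (axisSet T g) w p)
    (hp' : NearestPt T (axisSet T g) w' p') (hd : T.dist w p = T.dist w' p')
    (h0 : 0 < T.dist c p)
    (h : T.dist c p = T.dist c p') (hl : lt p p') : lt w w' := by
  have h1 := through hT hc hp (by rintro rfl; simp at h0)
  have h2 := through hT hc hp' (by rintro rfl; rw [SimpleGraph.dist_self] at h; omega)
  have h3 := gate hT hc hp.1
  have h4 := gate hT hc hp'.1
  have c1 := dcomm (T := T) w p
  have c2 := dcomm (T := T) w' p'
  refine hlt.lex w w' (by omega) p p' ?_ ?_ (by omega) hl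
  · change T.dist v0 p + T.dist p w = T.dist v0 w
    omega
  · change T.dist v0 p' + T.dist p' w' = T.dist v0 w'
    omega

theorem key (hT : T.IsTree) (hlt : IsPathOrder T v0 lt) {g : T ≃g T} (hg : IsHyperbolic T g)
    {c w p : V} (hc : NearestPt T (axisSet T g) v0 c) (hp : NearestPt T (axisSet T g) w p) :
    PP lt g w ↔ inU0 T lt g c p := by
  have hl := tl_pos hT hg
  have n1 := near_map hT hp
  have n2 := near_map_inv hT hp
  have d1 : T.dist w p = T.dist (g w) (g p) := (iso_dist hT g w p).symm
  have d2 : T.dist w p = T.dist (g⁻¹ w) (g⁻¹ p) := (iso_dist hT g⁻¹ w p).symm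
  have l := line hT hg hc.1 hp.1
  have ne1 : g p ≠ p := fun h => hg (Or.inl ⟨p, h⟩)
  have ne2 : g⁻¹ p ≠ p := fun h => hyp_inv hg (Or.inl ⟨p, h⟩)
  constructor
  · rintro ⟨h1, h2⟩
    have a1 : T.dist c p ≤ T.dist c (g p) := by
      by_contra hh
      exact lt_asymm' hlt h1 (cmp_lt hT hlt hc n1 hp d1.symm (by omega))
    have a2 : T.dist c p ≤ T.dist c (g⁻¹ p) := by
      by_contra hh
      exact lt_asymm' hlt h2 (cmp_lt hT hlt hc n2 hp d2.symm (by omega))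
    by_cases hk : 2 * T.dist c p < tl T g
    · left; exact hk
    right
    have hk' : 2 * T.dist c p = tl T g := by omega
    refine ⟨hk', fun p' hp' he hne => ?_⟩
    rcases opp hT hg hc.1 hp.1 hp' hk' (by omega) hne with rfl | rfl
    · rcases lt_tri hlt p (g p) with h | h | h
      · exact h
      · exact absurd h.symm ne1
      · exact (lt_asymm' hlt h1 (cmp_eq hT hlt hc n1 hp d1.symm (by omega) he h)).elim
    · rcases lt_tri hlt p (g⁻¹ p) with h | h | h
      · exact h
      · exact absurd h.symm ne2
      · exact (lt_asymm' hlt h2 (cmp_eq hT hlt hc n2 hp d2.symm (by omega) he h)).elim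
  · rintro (hk | ⟨hk, hh⟩)
    · exact ⟨cmp_lt hT hlt hc hp n1 d1 (by omega), cmp_lt hT hlt hc hp n2 d2 (by omega)⟩
    · constructor
      · by_cases he : T.dist c (g p) = T.dist c p
        · exact cmp_eq hT hlt hc hp n1 d1 (by omega) he.symm (hh _ n1.1 he ne1)
        · exact cmp_lt hT hlt hc hp n1 d1 (by omega)
      · by_cases he : T.dist c (g⁻¹ p) = T.dist c p
        · exact cmp_eq hT hlt hc hp n2 d2 (by omega) he.symm (hh _ n2.1 he ne2)
        · exact cmp_lt hT hlt hc hp n2 d2 (by omega)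

theorem U0_le {g : T ≃g T} {c p : V} (h : inU0 T lt g c p) : 2 * T.dist c p ≤ tl T g := by
  rcases h with h | h
  · omega
  · exact h.1.le

theorem PP_v0 (hT : T.IsTree) (hlt : IsPathOrder T v0 lt) {g : T ≃g T} (hg : IsHyperbolic T g) :
    PP lt g v0 := by
  obtain ⟨c, hc⟩ := exists_near hT g v0
  rw [key hT hlt hg hc hc]
  left
  simpa using tl_pos hT hg

theorem PP_convex (hT : T.IsTree) (hlt : IsPathOrder T v0 lt) {g : T ≃g T}
    (hg : IsHyperbolic T g) {a b x : V} (ha : PP lt g a) (hb : PP lt g b)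
    (hx : T.dist a x + T.dist x b = T.dist a b) : PP lt g x := by
  obtain ⟨c, hc⟩ := exists_near hT g v0
  obtain ⟨pa, hpa⟩ := exists_near hT g a
  obtain ⟨pb, hpb⟩ := exists_near hT g b
  obtain ⟨p, hp⟩ := exists_near hT g x
  rw [key hT hlt hg hc hpa] at ha
  rw [key hT hlt hg hc hpb] at hb
  rw [key hT hlt hg hc hp]
  have hl := tl_pos hT hg
  have hbt := proj_btw hT hpa hpb hp hx
  have la := U0_le ha
  have lb := U0_le hb
  by_cases e1 : p = pa
  · rwa [e1]
  by_cases e2 : p = pb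
  · rwa [e2]
  left
  have ta := dtri hT pa c pb
  have cc1 := dcomm (T := T) pa c
  have cc2 := dcomm (T := T) pa p
  have f := four hT c p pa pb
  by_contra hk
  have hk' : 2 * T.dist c p = tl T g := by omega
  have A : 2 * T.dist c pa = tl T g → T.dist p pa = tl T g := by
    intro h
    rcases opp hT hg hc.1 hp.1 hpa.1 hk' h (Ne.symm e1) with r | r <;> rw [r]
    · exact hp.1
    · rw [dist_self_inv hT]; exact hp.1
  have B : 2 * T.dist c pb = tl T g → T.dist p pb = tl T g := by
    intro h
    rcases opp hT hg hc.1 hp.1 hpb.1 hk' h (Ne.symm e2) with r | r <;> rw [r]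
    · exact hp.1
    · rw [dist_self_inv hT]; exact hp.1
  have q1 := hT.connected.pos_dist_of_ne e1
  have q2 := hT.connected.pos_dist_of_ne e2
  omega

/-- forward direction for one pair -/
theorem fwd (hT : T.IsTree) (hlt : IsPathOrder T v0 lt) {g h : T ≃g T}
    (hg : IsHyperbolic T g) (hh : IsHyperbolic T h)
    (H1 : ∀ z ∈ axisSet T h, PP lt g z) (H2 : ∀ z ∈ axisSet T g, PP lt h z) :
    PP lt g (h v0) := by
  obtain ⟨cg, hcg⟩ := exists_near hT g v0
  obtain ⟨c, hc⟩ := exists_near hT h v0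
  have n := near_map hT hc
  obtain ⟨p, hp⟩ := exists_near hT g (h v0)
  obtain ⟨q, hq⟩ := exists_near hT g (h c)
  have h1 := H1 _ n.1
  by_cases e : p = q
  · subst e
    rw [key hT hlt hg hcg hp, ← key hT hlt hg hcg hq]
    exact h1
  exfalso
  have t := through hT hp hq e
  have t1 := dtri hT p q (h c)
  have t2 := dtri hT (h v0) p (h c)
  have c1 := dcomm (T := T) q (h c)
  have n2 := near_btw hT n (x := p) (by omega)
  have h2 := H2 p hp.1
  rw [key hT hlt hh hc n2] at h2
  have h3 := U0_le h2
  have h4 : T.dist c (h c) = tl T h := hc.1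
  have h5 := tl_pos hT hh
  omega

/-- The fundamental segment `[c, h c]` lies on `[v0, h v0]`. -/
theorem seg_mem (hT : T.IsTree) {h : T ≃g T} (hh : IsHyperbolic T h) {c z : V}
    (hc : NearestPt T (axisSet T h) v0 c)
    (hz : T.dist c z + T.dist z (h c) = T.dist c (h c)) :
    T.dist v0 z + T.dist z (h v0) = T.dist v0 (h v0) := by
  have n := near_map hT hc
  have ne : c ≠ h c := fun e => hh (Or.inl ⟨c, e.symm⟩)
  have t := through hT hc n ne
  have t1 := dtri hT v0 c z
  have t2 := dtri hT z (h c) (h v0)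
  have t3 := dtri hT v0 z (h v0)
  have c1 := dcomm (T := T) (h c) (h v0)
  omega

/-- points of `U_g^0` satisfy any `PP` satisfied by `g^{±1} v0`. -/
theorem U0_PP (hT : T.IsTree) (hlt : IsPathOrder T v0 lt) {g h : T ≃g T}
    (hg : IsHyperbolic T g) (hh : IsHyperbolic T h)
    (H1 : PP lt h (g v0)) (H2 : PP lt h (g⁻¹ v0)) {c p : V}
    (hc : NearestPt T (axisSet T g) v0 c) (hp : p ∈ axisSet T g)
    (hk : T.dist c p ≤ tl T g) : PP lt h p := by
  have hc1 : T.dist c (g c) = tl T g := hc.1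
  have hc2 := dist_self_inv hT g c
  rcases axis_pos hT hg hc.1 hp with e | e
  · exact PP_convex hT hlt hh (PP_v0 hT hlt hh) H1 (seg_mem hT hg hc (by omega))
  · refine PP_convex hT hlt hh (PP_v0 hT hlt hh) H2 (seg_mem hT (hyp_inv hg) (c := c) ?_ (by omega))
    rwa [axis_inv hT]

theorem bwd_aux (hT : T.IsTree) (hlt : IsPathOrder T v0 lt) {g h : T ≃g T}
    (hg : IsHyperbolic T g) (hh : IsHyperbolic T h)
    (H1 : PP lt g (h v0))
    (H3 : PP lt h (g v0)) (H4 : PP lt h (g⁻¹ v0))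
    {c z : V} (hc : NearestPt T (axisSet T h) v0 c) (hz : z ∈ axisSet T h)
    (hk : tl T h ≤ T.dist c z)
    (he : T.dist z (h c) = T.dist c z - tl T h) : PP lt g z := by
  have hl := tl_pos hT hh
  have hc1 : T.dist c (h c) = tl T h := hc.1
  have P1 : PP lt g (h c) := by
    refine PP_convex hT hlt hg (PP_v0 hT hlt hg) H1 (seg_mem hT hh hc ?_)
    simp
  obtain ⟨cg, hcg⟩ := exists_near hT g v0
  obtain ⟨p0, hp0⟩ := exists_near hT g (h c)
  obtain ⟨p, hp⟩ := exists_near hT g z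
  by_cases e : p0 = p
  · subst e
    rw [key hT hlt hg hcg hp, ← key hT hlt hg hcg hp0]
    exact P1
  exfalso
  have t := through hT hp0 hp e
  have t1 := dtri hT p0 p z
  have t2 := dtri hT (h c) p0 z
  have c1 := dcomm (T := T) z p
  have c2 := dcomm (T := T) z (h c)
  have ax := axis_convex hT h _ (axis_map hT h hc.1) _ hz p0 (by omega)
  rw [key hT hlt hg hcg hp0] at P1
  have l1 := U0_le P1
  have P2 := U0_PP hT hlt hg hh H3 H4 hcg hp0.1 (by omega)
  rw [key hT hlt hh hc (near_self ax)] at P2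
  have l2 := U0_le P2
  have t3 := dtri hT c p0 z
  omega

theorem bwd (hT : T.IsTree) (hlt : IsPathOrder T v0 lt) {g h : T ≃g T}
    (hg : IsHyperbolic T g) (hh : IsHyperbolic T h)
    (H1 : PP lt g (h v0)) (H2 : PP lt g (h⁻¹ v0))
    (H3 : PP lt h (g v0)) (H4 : PP lt h (g⁻¹ v0))
    {z : V} (hz : z ∈ axisSet T h) : PP lt g z := by
  obtain ⟨c, hc⟩ := exists_near hT h v0
  by_cases hk : T.dist c z ≤ tl T h
  · exact U0_PP hT hlt hh hg H1 H2 hc hz hk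
  rcases axis_pos hT hh hc.1 hz with e | e
  · exact bwd_aux hT hlt hg hh H1 H3 H4 hc hz (by omega) (by omega)
  · refine bwd_aux hT hlt hg (hyp_inv hh) H2 ((PP_inv _ _).2 H3) ((PP_inv _ _).2 H4) (c := c)
      ?_ ?_ ?_ ?_
    · rwa [axis_inv hT]
    · rwa [axis_inv hT]
    · rw [tl_inv hT]; omega
    · rw [tl_inv hT]; omega

/-- `h v0` precedes `h² v0`. -/
theorem lt_sq (hT : T.IsTree) (hlt : IsPathOrder T v0 lt) {h : T ≃g T} (hh : IsHyperbolic T h) :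
    lt (h v0) (h (h v0)) := by
  obtain ⟨c, hc⟩ := exists_near hT h v0
  have n := near_map hT hc
  refine cmp_lt hT hlt hc n (near_map hT n) (iso_dist hT h _ _).symm ?_
  have h1 := axis_double hT hh hc.1
  have h2 : T.dist c (h c) = tl T h := hc.1
  have h3 := tl_pos hT hh
  omega

end Key

/-- a set of hyperbolic automorphisms satisfying N1 admits a
fundamental system iff [v0, h·v0] < [v0, gh·v0] for all g ≠ h⁻¹ in X^±. -/
theorem statement_16 {V : Type*} (T : SimpleGraph V) (hT : T.IsTree) (v0 : V)
    (lt : V → V → Prop) (hlt : IsPathOrder T v0 lt)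
    (X : Set (T ≃g T)) (hXfin : X.Finite)
    (hhyp : ∀ x ∈ X, IsHyperbolic T x) (hN1 : X ∩ X⁻¹ = ∅) :
    AdmitsFundamentalSystem T v0 lt X ↔
      ∀ g ∈ Xpm T X, ∀ h ∈ Xpm T X, g ≠ h⁻¹ → lt (h v0) ((g * h) v0) := by
  have hpm : ∀ g ∈ Xpm T X, ∃ x ∈ X, g = x ∨ g = x⁻¹ := by
    rintro g (hg | hg)
    · exact ⟨g, hg, Or.inl rfl⟩
    · exact ⟨g⁻¹, hg, Or.inr (by simp)⟩
  constructor
  · rintro ⟨-, hF⟩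
    have H : ∀ g ∈ X, ∀ h ∈ X, g ≠ h → ∀ z ∈ axisSet T h, PP lt g z := by
      intro g hg h hh hne z hz
      obtain ⟨c, hc⟩ := exists_near hT g v0
      obtain ⟨p, hp⟩ := exists_near hT g z
      rw [key hT hlt (hhyp g hg) hc hp]
      exact hF g hg h hh hne c z p hc hz hp
    have K : ∀ g ∈ X, ∀ h ∈ X, g ≠ h → PP lt g (h v0) ∧ PP lt g (h⁻¹ v0) := by
      intro g hg h hh hne
      refine ⟨fwd hT hlt (hhyp g hg) (hhyp h hh) (H g hg h hh hne) (H h hh g hg hne.symm),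
        fwd hT hlt (hhyp g hg) (hyp_inv (hhyp h hh)) ?_ ?_⟩
      · rw [axis_inv hT]; exact H g hg h hh hne
      · intro z hz
        exact (PP_inv _ _).2 (H h hh g hg hne.symm z hz)
    intro g' hg' h' hh' hne
    obtain ⟨g, hg, eg⟩ := hpm g' hg'
    obtain ⟨h, hh, eh⟩ := hpm h' hh'
    rcases eg with eg | eg <;> rcases eh with eh | eh <;> rw [eg, eh] at hne ⊢ <;>
      clear eg eh <;> by_cases e : g = h
    · subst e; exact lt_sq hT hlt (hhyp _ hg)
    · exact (K _ hg _ hh e).1.1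
    · subst e; simp at hne
    · exact (K _ hg _ hh e).2.1
    · subst e; simp at hne
    · exact (K _ hg _ hh e).1.2
    · subst e; exact lt_sq hT hlt (hyp_inv (hhyp _ hg))
    · exact (K _ hg _ hh e).2.2
  · intro hR
    refine ⟨fun x hx _ => hhyp x hx, ?_⟩
    have hm : ∀ g ∈ X, g ∈ Xpm T X := fun g hg => Or.inl hg
    have hm' : ∀ g ∈ X, g⁻¹ ∈ Xpm T X := fun g hg => Or.inr (by simpa using hg)
    have hn : ∀ g ∈ X, ∀ h ∈ X, g ≠ h⁻¹ := by
      rintro g hg h hh rfl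
      have : h⁻¹ ∈ X ∩ X⁻¹ := ⟨hg, by simpa using hh⟩
      rw [hN1] at this
      exact this
    have K : ∀ g ∈ X, ∀ h ∈ X, g ≠ h → PP lt g (h v0) ∧ PP lt g (h⁻¹ v0) := by
      intro g hg h hh hne
      refine ⟨⟨hR g (hm g hg) h (hm h hh) (hn g hg h hh),
        hR g⁻¹ (hm' g hg) h (hm h hh) (by simpa using hne)⟩,
        ⟨hR g (hm g hg) h⁻¹ (hm' h hh) (by simpa using hne),
        hR g⁻¹ (hm' g hg) h⁻¹ (hm' h hh) ?_⟩⟩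
      rw [inv_inv]
      exact (hn h hh g hg).symm
    intro g hg h hh hne c z p hc hz hp
    rw [← key hT hlt (hhyp g hg) hc hp]
    have k1 := K g hg h hh hne
    have k2 := K h hh g hg hne.symm
    exact bwd hT hlt (hhyp g hg) (hhyp h hh) k1.1 k1.2 k2.1 k2.2 hz

end TreePaper

end
end
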